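/- arXiv:1504.07875 — 4 statements merged into one kernel-verified Lean document; each statement's English description precedes it below -/
import Mathlib

section
/- Fix integers k ≥ 2 and l ≥ 0, and set p1 = l·F(2k−1)² + F(2k−3)², q1 = l·F(2k+1)² + F(2k−1)² + 2, p2 = F(2k−1)², q2 = p1, and d = F(2k−1)·F(2k+1)·p1. Let Γ be the additive submonoid of ℕ generated by g0 = p1·p2, g1 = q1·p2, g2 = p1·p2·q1 + q2, and let R(n) = #(Γ ∩ [0,n]). Then R(j·d) = (j+1)(j+2)/2 for every integer j with 0 ≤ j ≤ d−3. -/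
/-- Consecutive odd-index Fibonacci numbers form a Markov triple together with `1`. -/
theorem Nat.fib_odd_markov (m : ℕ) :
    fib (2 * m + 1) ^ 2 + fib (2 * m + 3) ^ 2 + 1 = 3 * (fib (2 * m + 1) * fib (2 * m + 3)) := by
  induction m with
  | zero => decide
  | succ m ih =>
    have e1 : fib (2 * m + 3) = fib (2 * m + 1) + fib (2 * m + 2) := fib_add_two
    have e2 : fib (2 * m + 4) = fib (2 * m + 2) + fib (2 * m + 3) := fib_add_two
    have e3 : fib (2 * m + 5) = fib (2 * m + 3) + fib (2 * m + 4) := fib_add_two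
    rw [show 2 * (m + 1) + 1 = 2 * m + 3 by ring, show 2 * (m + 1) + 3 = 2 * m + 5 by ring]
    rw [e3, e2]
    rw [e1] at ih ⊢
    linarith

theorem Nat.fib_odd_add (m : ℕ) :
    fib (2 * m + 1) + fib (2 * m + 5) = 3 * fib (2 * m + 3) := by
  have e1 : fib (2 * m + 3) = fib (2 * m + 1) + fib (2 * m + 2) := fib_add_two
  have e2 : fib (2 * m + 4) = fib (2 * m + 2) + fib (2 * m + 3) := fib_add_two
  have e3 : fib (2 * m + 5) = fib (2 * m + 3) + fib (2 * m + 4) := fib_add_two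
  omega

/-- The lattice points of the `j`-th dilate of the triangle with vertices
`(0, 0)`, `(c / b, 0)`, `(0, b / c)`. -/
def markovTriangle (b c j : ℕ) : Finset (ℕ × ℕ) :=
  (Finset.range (j * c + 1) ×ˢ Finset.range (j * b + 1)).filter
    fun p => b ^ 2 * p.1 + c ^ 2 * p.2 ≤ j * (b * c)

theorem mem_markovTriangle {b c : ℕ} (hb : 0 < b) (hc : 0 < c) {j : ℕ} {p : ℕ × ℕ} :
    p ∈ markovTriangle b c j ↔ b ^ 2 * p.1 + c ^ 2 * p.2 ≤ j * (b * c) := by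
  simp only [markovTriangle, Finset.mem_filter, Finset.mem_product, Finset.mem_range,
    and_iff_right_iff_imp, Nat.lt_succ_iff]
  intro h
  constructor
  · have : b * (b * p.1) ≤ b * (j * c) := by nlinarith [Nat.zero_le (c ^ 2 * p.2)]
    exact (Nat.le_mul_of_pos_left _ hb).trans (Nat.le_of_mul_le_mul_left this hb)
  · have : c * (c * p.2) ≤ c * (j * b) := by nlinarith [Nat.zero_le (b ^ 2 * p.1)]
    exact (Nat.le_mul_of_pos_left _ hc).trans (Nat.le_of_mul_le_mul_left this hc)

theorem card_markovTriangle_filter_fst_eq_zero {b c : ℕ} (hb : 0 < b) (hc : 0 < c) (j : ℕ) :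
    ((markovTriangle b c j).filter fun p => p.1 = 0).card = j * b / c + 1 := by
  have : (markovTriangle b c j).filter (fun p => p.1 = 0) =
      (Finset.range (j * b / c + 1)).image fun y => (0, y) := by
    ext ⟨x, y⟩
    simp only [Finset.mem_filter, mem_markovTriangle hb hc, Finset.mem_image, Finset.mem_range,
      Prod.mk.injEq, Nat.lt_succ_iff, Nat.le_div_iff_mul_le hc]
    constructor
    · rintro ⟨h, rfl⟩
      exact ⟨y, Nat.le_of_mul_le_mul_left (by linarith : c * (y * c) ≤ c * (j * b)) hc, rfl, rfl⟩
    · rintro ⟨y, h, rfl, rfl⟩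
      exact ⟨by nlinarith, rfl⟩
  rw [this, Finset.card_image_of_injective _ (Prod.mk_right_injective 0), Finset.card_range]

theorem card_markovTriangle_filter_snd_eq_zero {b c : ℕ} (hb : 0 < b) (hc : 0 < c) (j : ℕ) :
    ((markovTriangle b c j).filter fun p => p.1 ≠ 0 ∧ p.2 = 0).card = j * c / b := by
  have : (markovTriangle b c j).filter (fun p => p.1 ≠ 0 ∧ p.2 = 0) =
      (Finset.range (j * c / b)).image fun x => (x + 1, 0) := by
    ext ⟨x, y⟩
    simp only [Finset.mem_filter, mem_markovTriangle hb hc, Finset.mem_image, Finset.mem_range,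
      Prod.mk.injEq, ← Nat.succ_le_iff, Nat.le_div_iff_mul_le hb]
    constructor
    · rintro ⟨h, hx, rfl⟩
      obtain ⟨x, rfl⟩ := Nat.exists_eq_succ_of_ne_zero hx
      exact ⟨x, Nat.le_of_mul_le_mul_left (by linarith : b * (x.succ * b) ≤ b * (j * c)) hb,
        rfl, rfl⟩
    · rintro ⟨x, h, rfl, rfl⟩
      exact ⟨by nlinarith, by omega, rfl⟩
  rw [this, Finset.card_image_of_injective _ (fun x y h => by simpa using h), Finset.card_range]

theorem markovTriangle_filter_lt {b c : ℕ} (hb : 0 < b) (hc : 0 < c)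
    (h : b ^ 2 + c ^ 2 + 1 = 3 * (b * c)) (j : ℕ) :
    (markovTriangle b c j).filter
      (fun p => (p.1 ≠ 0 ∧ p.2 ≠ 0) ∧ b ^ 2 * p.1 + c ^ 2 * p.2 < j * (b * c)) =
      if 3 ≤ j then (markovTriangle b c (j - 3)).image fun p => (p.1 + 1, p.2 + 1) else ∅ := by
  ext ⟨x, y⟩
  simp only [Finset.mem_filter, mem_markovTriangle hb hc]
  split_ifs with hj
  · obtain ⟨i, rfl⟩ := Nat.exists_eq_add_of_le' hj
    simp only [Finset.mem_image, mem_markovTriangle hb hc, Prod.exists, Prod.mk.injEq,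
      Nat.add_sub_cancel]
    constructor
    · rintro ⟨-, ⟨hx, hy⟩, hlt⟩
      obtain ⟨x, rfl⟩ := Nat.exists_eq_succ_of_ne_zero hx
      obtain ⟨y, rfl⟩ := Nat.exists_eq_succ_of_ne_zero hy
      exact ⟨x, y, by simp only [Nat.succ_eq_add_one] at hlt; linarith, rfl, rfl⟩
    · rintro ⟨x, y, hle, rfl, rfl⟩
      have : b ^ 2 * (x + 1) + c ^ 2 * (y + 1) < (i + 3) * (b * c) := by linarith
      exact ⟨this.le, ⟨by omega, by omega⟩, this⟩
  · simp only [Finset.notMem_empty, iff_false]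
    rintro ⟨-, ⟨hx, hy⟩, hlt⟩
    have h1 : b ^ 2 * 1 ≤ b ^ 2 * x := Nat.mul_le_mul_left _ (by omega)
    have h2 : c ^ 2 * 1 ≤ c ^ 2 * y := Nat.mul_le_mul_left _ (by omega)
    have h3 : j * (b * c) ≤ 2 * (b * c) := Nat.mul_le_mul_right _ (by omega)
    have h4 : 0 < b * c := Nat.mul_pos hb hc
    omega

theorem coprime_of_markov {b c : ℕ} (h : b ^ 2 + c ^ 2 + 1 = 3 * (b * c)) : b.Coprime c := by
  rw [← Nat.isCoprime_iff_coprime]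
  refine ⟨3 * c - b, -c, ?_⟩
  zify at h
  linarith

theorem card_markovTriangle_filter_eq {b c : ℕ} (hb : 0 < b) (hc : 0 < c)
    (h : b ^ 2 + c ^ 2 + 1 = 3 * (b * c)) (j : ℕ) :
    ((markovTriangle b c j).filter
      (fun p => (p.1 ≠ 0 ∧ p.2 ≠ 0) ∧ ¬ b ^ 2 * p.1 + c ^ 2 * p.2 < j * (b * c))).card =
      3 * j - j * b / c - j * c / b - 1 := by
  have hcop := coprime_of_markov h
  have hz : (b : ℤ) ^ 2 + c ^ 2 + 1 = 3 * (b * c) := by exact_mod_cast h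
  have hmem (t : ℕ) : t ∈ Finset.Ioo (j * c / b) (3 * j - j * b / c) ↔
      j * c < b * t ∧ j * b + c * t < 3 * j * c := by
    rw [Finset.mem_Ioo, Nat.div_lt_iff_lt_mul hb, mul_comm t]
    refine and_congr_right fun _ => ?_
    have : t < 3 * j - j * b / c ↔ t < 3 * j ∧ j * b / c < 3 * j - t := by
      generalize j * b / c = m
      omega
    rw [this, Nat.div_lt_iff_lt_mul hc, Nat.sub_mul]
    constructor
    · rintro ⟨-, h2⟩
      rw [mul_comm c]
      omega
    · intro h2
      have : t * c < 3 * j * c := by linarith [Nat.zero_le (j * b)]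
      refine ⟨Nat.lt_of_mul_lt_mul_right this, ?_⟩
      rw [mul_comm c] at h2
      omega
  have : (markovTriangle b c j).filter
      (fun p => (p.1 ≠ 0 ∧ p.2 ≠ 0) ∧ ¬ b ^ 2 * p.1 + c ^ 2 * p.2 < j * (b * c)) =
      (Finset.Ioo (j * c / b) (3 * j - j * b / c)).image
        fun t => (c * (3 * j * c - (j * b + c * t)), b * (b * t - j * c)) := by
    ext ⟨x, y⟩
    simp only [Finset.mem_filter, mem_markovTriangle hb hc, Finset.mem_image, Prod.mk.injEq, hmem]
    constructor
    · rintro ⟨hle, ⟨hx, hy⟩, hlt⟩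
      have heq : b ^ 2 * x + c ^ 2 * y = j * (b * c) := le_antisymm hle (not_lt.1 hlt)
      have hcx : c ∣ x := by
        have : c ∣ b ^ 2 * x :=
          (Nat.dvd_add_left (Dvd.intro (c * y) (by ring))).1
            (heq ▸ Dvd.intro_left (j * b) (by ring) : c ∣ b ^ 2 * x + c ^ 2 * y)
        exact (hcop.symm.pow_right 2).dvd_of_dvd_mul_left this
      have hby : b ∣ y := by
        have : b ∣ c ^ 2 * y :=
          (Nat.dvd_add_right (Dvd.intro (b * x) (by ring))).1
            (heq ▸ Dvd.intro_left (j * c) (by ring) : b ∣ b ^ 2 * x + c ^ 2 * y)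
        exact (hcop.pow_right 2).dvd_of_dvd_mul_left this
      obtain ⟨u, rfl⟩ := hcx
      obtain ⟨v, rfl⟩ := hby
      have hj : b * u + c * v = j := by
        refine Nat.eq_of_mul_eq_mul_right (Nat.mul_pos hb hc) ?_
        linarith
      have hu : 0 < u := Nat.pos_of_ne_zero fun h0 => hx (by simp [h0])
      have hv : 0 < v := Nat.pos_of_ne_zero fun h0 => hy (by simp [h0])
      -- `t = c * u + (3 * c - b) * v` parametrizes the solution
      have hbc : b ≤ 3 * c := by nlinarith
      obtain ⟨e, he⟩ := Nat.exists_eq_add_of_le hbc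
      have he' : b * e = c ^ 2 + 1 := by nlinarith
      have h1 : b * (c * u + e * v) = j * c + v := by
        rw [← hj]; linear_combination v * he'
      have h2 : 3 * j * c = j * b + c * (c * u + e * v) + u := by
        rw [← hj]
        linear_combination (c * v + b * u) * he + u * he'
      refine ⟨c * u + e * v, ⟨by omega, by omega⟩, ?_, ?_⟩
      · congr 1; omega
      · congr 1; omega
    · rintro ⟨t, ⟨h1, h2⟩, rfl, rfl⟩
      obtain ⟨v, hv⟩ := Nat.exists_eq_add_of_lt h1
      obtain ⟨u, hu⟩ := Nat.exists_eq_add_of_lt h2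
      have e1 : b * t - j * c = v + 1 := by omega
      have e2 : 3 * j * c - (j * b + c * t) = u + 1 := by omega
      rw [e1, e2]
      have heq : b ^ 2 * (c * (u + 1)) + c ^ 2 * (b * (v + 1)) = j * (b * c) := by
        zify at hv hu ⊢
        linear_combination (-b ^ 2 * c : ℤ) * hu - (c ^ 2 * b : ℤ) * hv - (j * b * c : ℤ) * hz
      exact ⟨heq.le, ⟨by positivity, by positivity⟩, heq.not_lt⟩
  rw [this, Finset.card_image_of_injOn, Nat.card_Ioo, Nat.sub_right_comm _ (j * b / c)]
  · intro s hs t ht hst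
    rw [Finset.mem_coe, hmem] at hs ht
    have := Nat.eq_of_mul_eq_mul_left hb (Prod.mk.inj hst).2
    exact Nat.eq_of_mul_eq_mul_left hb (by omega)

/-- Period collapse: the triangles attached to Markov pairs have the Ehrhart function of the
standard triangle. -/
theorem two_mul_card_markovTriangle {b c : ℕ} (hb : 0 < b) (hc : 0 < c)
    (h : b ^ 2 + c ^ 2 + 1 = 3 * (b * c)) (j : ℕ) :
    2 * (markovTriangle b c j).card = (j + 1) * (j + 2) := by
  induction j using Nat.strong_induction_on with
  | _ j ih =>
  have h0 := card_markovTriangle_filter_fst_eq_zero hb hc j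
  have h1 := card_markovTriangle_filter_snd_eq_zero hb hc j
  have h2 := congrArg Finset.card (markovTriangle_filter_lt hb hc h j)
  have h3 := card_markovTriangle_filter_eq hb hc h j
  have s0 := (markovTriangle b c j).card_filter_add_card_filter_not fun p => p.1 = 0
  have s1 := ((markovTriangle b c j).filter fun p => ¬ p.1 = 0).card_filter_add_card_filter_not
    fun p => p.2 = 0
  have s2 := ((markovTriangle b c j).filter
    fun p => p.1 ≠ 0 ∧ p.2 ≠ 0).card_filter_add_card_filter_not
    fun p => b ^ 2 * p.1 + c ^ 2 * p.2 < j * (b * c)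
  simp only [Finset.filter_filter, ne_eq] at h0 h1 h2 h3 s0 s1 s2
  rcases Nat.eq_zero_or_pos j with rfl | hj
  · rw [if_neg (by omega), Finset.card_empty] at h2
    simp only [zero_mul, mul_zero, Nat.zero_div, Nat.sub_zero, Nat.zero_sub, zero_add] at *
    omega
  have hlt : j * b / c + j * c / b < 3 * j := by
    have e1 : c * (j * b / c) ≤ j * b := Nat.mul_div_le _ _
    have e2 : b * (j * c / b) ≤ j * c := Nat.mul_div_le _ _
    refine Nat.lt_of_mul_lt_mul_left (a := b * c) ?_
    calc b * c * (j * b / c + j * c / b)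
        = b * (c * (j * b / c)) + c * (b * (j * c / b)) := by ring
      _ ≤ b * (j * b) + c * (j * c) := by gcongr
      _ < b * c * (3 * j) := by nlinarith
  split_ifs at h2 with h3j
  · rw [Finset.card_image_of_injective _ (by rintro ⟨_, _⟩ ⟨_, _⟩ h; simpa using h)] at h2
    have := ih (j - 3) (by omega)
    obtain ⟨i, rfl⟩ := Nat.exists_eq_add_of_le' h3j
    simp only [Nat.add_sub_cancel] at *
    have e : (i + 3 + 1) * (i + 3 + 2) = (i + 1) * (i + 2) + 6 * (i + 3) := by ring
    omega
  · simp only [Finset.card_empty] at h2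
    have : j = 1 ∨ j = 2 := by omega
    rcases this with rfl | rfl <;> omega

theorem AddSubmonoid.mem_closure_triple_nat {g₀ g₁ g₂ m : ℕ} :
    m ∈ AddSubmonoid.closure ({g₀, g₁, g₂} : Set ℕ) ↔
      ∃ x y z : ℕ, x * g₀ + y * g₁ + z * g₂ = m := by
  simp only [Set.insert_eq, AddSubmonoid.closure_union, AddSubmonoid.mem_sup, AddSubmonoid.mem_closure_singleton,
    smul_eq_mul]
  constructor
  · rintro ⟨_, ⟨x, rfl⟩, _, ⟨_, ⟨y, rfl⟩, _, ⟨z, rfl⟩, rfl⟩, rfl⟩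
    exact ⟨x, y, z, by ring⟩
  · rintro ⟨x, y, z, rfl⟩
    exact ⟨_, ⟨x, rfl⟩, _, ⟨_, ⟨y, rfl⟩, _, ⟨z, rfl⟩, rfl⟩, by ring⟩

/-- For two Newton pairs `(p, q)(b ^ 2, p)` with `p * c ^ 2 = q * b ^ 2 + 1`, the elements of the
semigroup up to `j * (b * c * p)` are counted by the triangle attached to `b` and `c`. -/
theorem ncard_semigroup_eq_card_markovTriangle {b c p q j : ℕ} (hb : 0 < b) (hc : 0 < c)
    (hp : 0 < p) (hcop : b.Coprime c) (hpq : p * c ^ 2 = q * b ^ 2 + 1) (hj : j < b * c * p) :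
    {m : ℕ | m ∈ AddSubmonoid.closure ({p * b ^ 2, q * b ^ 2, p * b ^ 2 * q + p} : Set ℕ) ∧
        m ≤ j * (b * c * p)}.ncard = (markovTriangle b c j).card := by
  set f : ℕ × ℕ → ℕ := fun v =>
    v.1 * (p * b ^ 2) + v.2 % p * (q * b ^ 2) + v.2 / p * (p * b ^ 2 * q + p) with hf
  have key (v : ℕ × ℕ) : f v + v.2 % p = p * (b ^ 2 * v.1 + c ^ 2 * v.2) := by
    have := Nat.mod_add_div v.2 p
    simp only [hf]
    generalize v.2 % p = r at *
    generalize v.2 / p = s at *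
    rw [← this]
    zify at hpq ⊢
    linear_combination (-(r + p * s : ℤ)) * hpq
  have hle (v : ℕ × ℕ) : f v ≤ j * (b * c * p) ↔ v ∈ markovTriangle b c j := by
    rw [mem_markovTriangle hb hc]
    have hr := Nat.mod_lt v.2 hp
    have hk := key v
    have e : j * (b * c * p) = p * (j * (b * c)) := by ring
    rw [e]
    constructor
    · intro h
      by_contra! hlt
      have := Nat.mul_le_mul_left p hlt
      rw [Nat.succ_eq_add_one, mul_add] at this
      omega
    · intro h
      have := Nat.mul_le_mul_left p h
      omega
  have himage : {m : ℕ | m ∈ AddSubmonoid.closure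
      ({p * b ^ 2, q * b ^ 2, p * b ^ 2 * q + p} : Set ℕ) ∧ m ≤ j * (b * c * p)} =
      f '' (markovTriangle b c j : Set (ℕ × ℕ)) := by
    ext m
    simp only [Set.mem_ofPred_eq, AddSubmonoid.mem_closure_triple_nat, Set.mem_image,
      Finset.mem_coe]
    constructor
    · rintro ⟨⟨x, y, z, rfl⟩, hm⟩
      have hv : f (x + y / p * q, y % p + p * z) =
          x * (p * b ^ 2) + y * (q * b ^ 2) + z * (p * b ^ 2 * q + p) := by
        simp only [hf, Nat.add_mul_mod_self_left, Nat.mod_mod, Nat.add_mul_div_left _ _ hp,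
          Nat.div_eq_of_lt (Nat.mod_lt y hp), zero_add]
        conv_rhs => rw [← Nat.mod_add_div y p]
        ring
      exact ⟨_, (hle _).1 (hv ▸ hm), hv⟩
    · rintro ⟨v, hv, rfl⟩
      exact ⟨⟨_, _, _, rfl⟩, (hle v).2 hv⟩
  have hpb : p.Coprime (b ^ 2) := by
    rw [← Nat.isCoprime_iff_coprime]
    refine ⟨c ^ 2, -q, ?_⟩
    push_cast
    zify at hpq
    linarith
  have hbound (v : ℕ × ℕ) (hv : v ∈ markovTriangle b c j) : v.2 < p * b ^ 2 := by
    rw [mem_markovTriangle hb hc] at hv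
    refine Nat.lt_of_mul_lt_mul_left (a := c ^ 2) ?_
    calc c ^ 2 * v.2 ≤ j * (b * c) := (Nat.le_add_left _ _).trans hv
      _ < b * c * p * (b * c) := Nat.mul_lt_mul_of_pos_right hj (Nat.mul_pos hb hc)
      _ = c ^ 2 * (p * b ^ 2) := by ring
  have hinj : Set.InjOn f (markovTriangle b c j : Set (ℕ × ℕ)) := by
    intro v hv w hw hvw
    have hmod : v.2 ≡ w.2 [MOD p] := by
      have h1 : f v + v.2 ≡ 0 [MOD p] :=
        ((Nat.mod_modEq v.2 p).symm.add_left (f v)).trans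
          (key v ▸ (Nat.modEq_zero_iff_dvd.2 (dvd_mul_right _ _)))
      have h2 : f w + w.2 ≡ 0 [MOD p] :=
        ((Nat.mod_modEq w.2 p).symm.add_left (f w)).trans
          (key w ▸ (Nat.modEq_zero_iff_dvd.2 (dvd_mul_right _ _)))
      exact Nat.ModEq.add_left_cancel' (f v) (h1.trans (hvw ▸ h2.symm))
    have heq : b ^ 2 * v.1 + c ^ 2 * v.2 = b ^ 2 * w.1 + c ^ 2 * w.2 := by
      refine Nat.eq_of_mul_eq_mul_left hp ?_
      rw [← key, ← key, hvw, show v.2 % p = w.2 % p from hmod]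
    have hmod' : v.2 ≡ w.2 [MOD b ^ 2] := by
      have : c ^ 2 * v.2 ≡ c ^ 2 * w.2 [MOD b ^ 2] := by
        have := congrArg (· % b ^ 2) heq
        simpa [Nat.ModEq] using this
      exact Nat.ModEq.cancel_left_of_coprime (hcop.pow 2 2) this
    have h2 : v.2 = w.2 :=
      Nat.ModEq.eq_of_lt_of_lt ((Nat.modEq_and_modEq_iff_modEq_mul hpb).1 ⟨hmod, hmod'⟩)
        (hbound v hv) (hbound w hw)
    refine Prod.ext (Nat.eq_of_mul_eq_mul_left (pow_pos hb 2) ?_) h2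
    rw [h2] at heq
    omega
  rw [himage, hinj.ncard_image, Set.ncard_coe_finset]

/-- Family (i) of the classification: for `k ≥ 2`, `l ≥ 0`, the singularity type
`(p1,q1)(p2,q2)` with `p1 = l·F(2k−1)² + F(2k−3)²`, `q1 = l·F(2k+1)² + F(2k−1)² + 2`,
`p2 = F(2k−1)²`, `q2 = p1`, and `d = F(2k−1)·F(2k+1)·p1` satisfies the Borodzik–Livingston
counting condition `R(j·d) = (j+1)(j+2)/2` for `0 ≤ j ≤ d−3`. -/
theorem counting_condition_family_i
    (k l p1 q1 p2 q2 d : ℕ) (hk : 2 ≤ k)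
    (hp1 : p1 = l * (Nat.fib (2 * k - 1)) ^ 2 + (Nat.fib (2 * k - 3)) ^ 2)
    (hq1 : q1 = l * (Nat.fib (2 * k + 1)) ^ 2 + (Nat.fib (2 * k - 1)) ^ 2 + 2)
    (hp2 : p2 = (Nat.fib (2 * k - 1)) ^ 2)
    (hq2 : q2 = p1)
    (hd : d = Nat.fib (2 * k - 1) * Nat.fib (2 * k + 1) * p1) :
    ∀ j : ℕ, j ≤ d - 3 →
      {m : ℕ | m ∈ AddSubmonoid.closure ({p1 * p2, q1 * p2, p1 * p2 * q1 + q2} : Set ℕ) ∧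
        m ≤ j * d}.ncard = (j + 1) * (j + 2) / 2 := by
  obtain ⟨n, rfl⟩ := Nat.exists_eq_add_of_le' hk
  rw [show 2 * (n + 2) - 1 = 2 * n + 3 by omega] at *
  rw [show 2 * (n + 2) - 3 = 2 * n + 1 by omega] at *
  rw [show 2 * (n + 2) + 1 = 2 * n + 5 by omega] at *
  have hM := Nat.fib_odd_markov n
  have hM' : Nat.fib (2 * n + 3) ^ 2 + Nat.fib (2 * n + 5) ^ 2 + 1 =
      3 * (Nat.fib (2 * n + 3) * Nat.fib (2 * n + 5)) := Nat.fib_odd_markov (n + 1)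
  have hA := Nat.fib_odd_add n
  have ha : 0 < Nat.fib (2 * n + 1) := Nat.fib_pos.2 (by omega)
  have hb : 0 < Nat.fib (2 * n + 3) := Nat.fib_pos.2 (by omega)
  have hc : 0 < Nat.fib (2 * n + 5) := Nat.fib_pos.2 (by omega)
  generalize Nat.fib (2 * n + 1) = a at *
  generalize Nat.fib (2 * n + 3) = b at *
  generalize Nat.fib (2 * n + 5) = c at *
  have hac : a * c = b ^ 2 + 1 := by nlinarith
  have hpq : p1 * c ^ 2 = q1 * b ^ 2 + 1 := by
    rw [hp1, hq1]
    have : (a * c) ^ 2 = (b ^ 2 + 1) ^ 2 := by rw [hac]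
    linarith
  have hp : 0 < p1 := by rw [hp1]; positivity
  intro j hj
  have hd0 : 0 < d := by rw [hd]; positivity
  rw [hp2, hq2, hd]
  rw [ncard_semigroup_eq_card_markovTriangle hb hc hp (coprime_of_markov hM') hpq (by omega)]
  have := two_mul_card_markovTriangle hb hc hM' j
  omega
end

section
/- Fix an integer n ≥ 3, and set d = n² + 1. Let Γ be the additive submonoid of ℕ generated by g0 = (n−1)·n, g1 = n² and g2 = n³ + 2n + 1 (the semigroup of the singularity of type (n−1, n)(n, (n+1)²)), and let R(n') = #(Γ ∩ [0,n']). Then R(j·d) = (j+1)(j+2)/2 for every integer j with 0 ≤ j ≤ d−3. -/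
/-- Triples `(a, c, k)` with `a, c < n`, standing for the semigroup element
`a * g₀ + (k - c * n - a) * g₁ + c * g₂ = n ^ 2 * k + 2 * n * c + c - n * a`, bounded by
`j * (n ^ 2 + 1)`. -/
def normalForms (n j : ℕ) : Finset (ℕ × ℕ × ℕ) :=
  (Finset.range n ×ˢ Finset.range n ×ˢ Finset.range (j + 2)).filter fun p =>
    p.2.1 * n + p.1 ≤ p.2.2 ∧
      n ^ 2 * p.2.2 + 2 * n * p.2.1 + p.2.1 ≤ j * (n ^ 2 + 1) + n * p.1

/-- Triples `(a, c, k)` with `a, c < n` and `c * n + a ≤ k ≤ j`. -/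
def triangleTriples (n j : ℕ) : Finset (ℕ × ℕ × ℕ) :=
  (Finset.range n ×ˢ Finset.range n ×ˢ Finset.range (j + 1)).filter fun p =>
    p.2.1 * n + p.1 ≤ p.2.2

theorem mem_normalForms {n j a c k : ℕ} :
    (a, c, k) ∈ normalForms n j ↔ (a < n ∧ c < n ∧ k < j + 2) ∧ c * n + a ≤ k ∧
      n ^ 2 * k + 2 * n * c + c ≤ j * (n ^ 2 + 1) + n * a := by
  simp [normalForms]

theorem mem_triangleTriples {n j a c k : ℕ} :
    (a, c, k) ∈ triangleTriples n j ↔ (a < n ∧ c < n ∧ k < j + 1) ∧ c * n + a ≤ k := by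
  simp [triangleTriples]

theorem card_triangleTriples {n j : ℕ} (hj : j + 2 ≤ n ^ 2) :
    (triangleTriples n j).card = (j + 1) * (j + 2) / 2 := by
  have hn : 0 < n := by
    rcases Nat.eq_zero_or_pos n with h | h
    · subst h; omega
    · exact h
  have hcard : (triangleTriples n j).card =
      ((Finset.range (j + 1)).sigma fun k => Finset.range (k + 1)).card := by
    refine Finset.card_bij' (fun p _ => ⟨p.2.2, p.2.1 * n + p.1⟩)
      (fun q _ => (q.2 % n, q.2 / n, q.1)) ?_ ?_ ?_ ?_
    · rintro ⟨a, c, k⟩ h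
      rw [mem_triangleTriples] at h
      simp only [Finset.mem_sigma, Finset.mem_range]
      omega
    · rintro ⟨k, r⟩ h
      simp only [Finset.mem_sigma, Finset.mem_range] at h
      rw [mem_triangleTriples]
      refine ⟨⟨Nat.mod_lt _ hn, ?_, h.1⟩, ?_⟩
      · dsimp only
        rw [Nat.div_lt_iff_lt_mul hn]
        nlinarith
      · dsimp only
        rw [Nat.div_add_mod']
        omega
    · rintro ⟨a, c, k⟩ h
      rw [mem_triangleTriples] at h
      have h1 : (c * n + a) % n = a := by
        rw [Nat.mul_add_mod_self_right, Nat.mod_eq_of_lt h.1.1]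
      have h2 : (c * n + a) / n = c := by
        rw [mul_comm, Nat.mul_add_div hn, Nat.div_eq_of_lt h.1.1, add_zero]
      simp [h1, h2]
    · rintro ⟨k, r⟩ h
      simp [Nat.div_add_mod']
  rw [hcard, Finset.card_sigma]
  simp only [Finset.card_range]
  have hs := Finset.sum_range_id_mul_two (j + 2)
  rw [Finset.sum_range_succ'] at hs
  simp only [add_zero, show j + 2 - 1 = j + 1 from rfl] at hs
  rw [eq_comm]
  apply Nat.div_eq_of_eq_mul_left two_pos
  rw [hs, mul_comm]

theorem mem_triangleTriples_sdiff {n j a c k : ℕ} (hj : j + 2 ≤ n ^ 2) :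
    (a, c, k) ∈ triangleTriples n j \ normalForms n j ↔
      (a < n ∧ c < n) ∧ k = j ∧ c * n + a ≤ j ∧ j + n * a < 2 * n * c + c := by
  rw [Finset.mem_sdiff, mem_normalForms, mem_triangleTriples]
  constructor
  · rintro ⟨⟨⟨ha, hc, hk⟩, hr⟩, h⟩
    have h2 : j * (n ^ 2 + 1) + n * a < n ^ 2 * k + 2 * n * c + c := by
      by_contra! h3
      exact h ⟨⟨ha, hc, by omega⟩, hr, h3⟩
    have hkj : k = j := by
      by_contra hne
      have : k + 1 ≤ j := by omega
      have h5 : n ^ 2 * (k + 1) ≤ n ^ 2 * j := Nat.mul_le_mul_left _ this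
      have h6 : c ≤ a + (n - 1) := by omega
      have h7 : (n + 1) * c ≤ (n + 1) * (a + (n - 1)) := Nat.mul_le_mul_left _ h6
      obtain ⟨m, rfl⟩ : ∃ m, n = m + 1 := ⟨n - 1, by omega⟩
      simp only [Nat.add_sub_cancel] at h7
      nlinarith
    subst hkj
    exact ⟨⟨ha, hc⟩, rfl, hr, by nlinarith⟩
  · rintro ⟨⟨ha, hc⟩, rfl, hr, h⟩
    exact ⟨⟨⟨ha, hc, by omega⟩, hr⟩, fun h3 => by nlinarith [h3.2.2]⟩

theorem mem_normalForms_sdiff {n j a c k : ℕ} :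
    (a, c, k) ∈ normalForms n j \ triangleTriples n j ↔
      (a < n ∧ c < n) ∧ k = j + 1 ∧ c * n + a ≤ j + 1 ∧ n ^ 2 + 2 * n * c + c ≤ j + n * a := by
  rw [Finset.mem_sdiff, mem_normalForms, mem_triangleTriples]
  constructor
  · rintro ⟨⟨⟨ha, hc, hk⟩, hr, h⟩, h2⟩
    have hkj : k = j + 1 := by
      by_contra hne
      exact h2 ⟨⟨ha, hc, by omega⟩, hr⟩
    subst hkj
    exact ⟨⟨ha, hc⟩, rfl, hr, by nlinarith⟩
  · rintro ⟨⟨ha, hc⟩, rfl, hr, h⟩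
    exact ⟨⟨⟨ha, hc, by omega⟩, hr, by nlinarith⟩, by omega⟩

theorem quotient_bounds_of_mem_triangleTriples_sdiff {n j a c k : ℕ} (hj : j + 2 ≤ n ^ 2)
    (h : (a, c, k) ∈ triangleTriples n j \ normalForms n j) :
    a < c ∧ n * (c - a) ≤ j ∧ a ≤ (j - n * (c - a)) / (n + 1) ∧
      (j - n * (c - a)) / (n + 1) < c := by
  rw [mem_triangleTriples_sdiff hj] at h
  obtain ⟨⟨ha, hc⟩, -, hr, h⟩ := h
  have hac : a < c := by
    by_contra! hca
    have := Nat.mul_le_mul_left (n + 1) hca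
    nlinarith
  obtain ⟨δ, rfl⟩ := Nat.exists_eq_add_of_lt hac
  rw [show a + δ + 1 - a = δ + 1 by omega]
  have hb : n * (δ + 1) ≤ j := by nlinarith
  refine ⟨hac, hb, ?_, ?_⟩
  · rw [Nat.le_div_iff_mul_le (by omega), Nat.le_sub_iff_add_le hb]
    nlinarith
  · rw [Nat.div_lt_iff_lt_mul (by omega), Nat.sub_lt_iff_lt_add hb]
    nlinarith

theorem quotient_bounds_of_mem_normalForms_sdiff {n j a c k : ℕ} (hj : j + 2 ≤ n ^ 2)
    (h : (a, c, k) ∈ normalForms n j \ triangleTriples n j) :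
    c < a ∧ n * (n + c - a) ≤ j ∧ c ≤ (j - n * (n + c - a)) / (n + 1) ∧
      (j - n * (n + c - a)) / (n + 1) < a := by
  rw [mem_normalForms_sdiff] at h
  obtain ⟨⟨ha, hc⟩, -, hr, h⟩ := h
  have hca : c < a := by
    by_contra! hac
    have := Nat.mul_le_mul_left n hac
    nlinarith
  obtain ⟨δ, hδ⟩ : ∃ δ, n + c = a + δ := ⟨n + c - a, by omega⟩
  rw [show n + c - a = δ by omega]
  have hmul : n * n + n * c = n * a + n * δ := by rw [← mul_add, hδ, mul_add]
  have hb : n * δ ≤ j := by nlinarith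
  refine ⟨hca, hb, ?_, ?_⟩
  · rw [Nat.le_div_iff_mul_le (by omega), Nat.le_sub_iff_add_le hb]
    nlinarith
  · rw [Nat.div_lt_iff_lt_mul (by omega), Nat.sub_lt_iff_lt_add hb]
    nlinarith

theorem card_sdiff_eq {n j : ℕ} (hj : j + 2 ≤ n ^ 2) :
    (triangleTriples n j \ normalForms n j).card =
      (normalForms n j \ triangleTriples n j).card := by
  refine Finset.card_bij'
    (fun p _ => ((j - n * (p.2.1 - p.1)) / (n + 1) + n - p.2.1,
      (j - n * (p.2.1 - p.1)) / (n + 1) - p.1, j + 1))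
    (fun p _ => ((j - n * (n + p.2.1 - p.1)) / (n + 1) - p.2.1,
      (j - n * (n + p.2.1 - p.1)) / (n + 1) + n - p.1, j)) ?_ ?_ ?_ ?_
  · rintro ⟨a, c, k⟩ h
    obtain ⟨hac, hb, hM, hM'⟩ := quotient_bounds_of_mem_triangleTriples_sdiff hj h
    rw [mem_triangleTriples_sdiff hj] at h
    obtain ⟨⟨ha, hc⟩, -⟩ := h
    dsimp only
    have hq := Nat.div_mul_le_self (j - n * (c - a)) (n + 1)
    generalize (j - n * (c - a)) / (n + 1) = M at *
    rw [Nat.le_sub_iff_add_le hb] at hq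
    obtain ⟨δ, rfl⟩ := Nat.exists_eq_add_of_lt hac
    obtain ⟨i, rfl⟩ := Nat.exists_eq_add_of_le hM
    obtain ⟨e, rfl⟩ := Nat.exists_eq_add_of_lt hc
    rw [show a + δ + 1 - a = δ + 1 by omega] at hq
    rw [mem_normalForms_sdiff, Nat.add_sub_cancel_left,
      show a + i + (a + δ + 1 + e + 1) - (a + δ + 1) = a + i + (e + 1) by omega]
    refine ⟨⟨by omega, by omega⟩, rfl, by nlinarith, by nlinarith⟩
  · rintro ⟨a, c, k⟩ h
    obtain ⟨hca, hb, hM, hM'⟩ := quotient_bounds_of_mem_normalForms_sdiff hj h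
    rw [mem_normalForms_sdiff] at h
    obtain ⟨⟨ha, hc⟩, -⟩ := h
    dsimp only
    have hq := Nat.div_mul_le_self (j - n * (n + c - a)) (n + 1)
    have hq' := Nat.lt_mul_div_succ (j - n * (n + c - a)) (show 0 < n + 1 by omega)
    generalize (j - n * (n + c - a)) / (n + 1) = M at *
    rw [Nat.le_sub_iff_add_le hb] at hq
    rw [Nat.sub_lt_iff_lt_add hb] at hq'
    obtain ⟨i, rfl⟩ := Nat.exists_eq_add_of_le hM
    obtain ⟨e, rfl⟩ := Nat.exists_eq_add_of_lt ha
    rw [show a + e + 1 + c - a = e + 1 + c by omega] at hq hq'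
    rw [mem_triangleTriples_sdiff hj, Nat.add_sub_cancel_left,
      show c + i + (a + e + 1) - a = c + i + (e + 1) by omega]
    refine ⟨⟨by omega, by omega⟩, rfl, by nlinarith, by nlinarith⟩
  · rintro ⟨a, c, k⟩ h
    obtain ⟨hac, -, hM, hM'⟩ := quotient_bounds_of_mem_triangleTriples_sdiff hj h
    rw [mem_triangleTriples_sdiff hj] at h
    obtain ⟨⟨ha, hc⟩, rfl, -⟩ := h
    dsimp only
    have hδ : n + ((k - n * (c - a)) / (n + 1) - a) -
        ((k - n * (c - a)) / (n + 1) + n - c) = c - a := by omega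
    rw [hδ]
    ext <;> dsimp only <;> omega
  · rintro ⟨a, c, k⟩ h
    obtain ⟨hca, -, hM, hM'⟩ := quotient_bounds_of_mem_normalForms_sdiff hj h
    rw [mem_normalForms_sdiff] at h
    obtain ⟨⟨ha, hc⟩, rfl, -⟩ := h
    dsimp only
    have hδ : (j - n * (n + c - a)) / (n + 1) + n - a -
        ((j - n * (n + c - a)) / (n + 1) - c) = n + c - a := by omega
    rw [hδ]
    ext <;> dsimp only <;> omega

theorem card_normalForms {n j : ℕ} (hj : j + 2 ≤ n ^ 2) :
    (normalForms n j).card = (j + 1) * (j + 2) / 2 := by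
  rw [← card_triangleTriples hj]
  have h1 := Finset.card_sdiff_add_card_inter (triangleTriples n j) (normalForms n j)
  have h2 := Finset.card_sdiff_add_card_inter (normalForms n j) (triangleTriples n j)
  rw [Finset.inter_comm] at h2
  have := card_sdiff_eq hj
  omega

theorem mem_closure_iff_exists_normalForm {n : ℕ} (hn : 0 < n) (x : ℕ) :
    x ∈ AddSubmonoid.closure ({(n - 1) * n, n ^ 2, n ^ 3 + 2 * n + 1} : Set ℕ) ↔
      ∃ a c k, a < n ∧ c < n ∧ c * n + a ≤ k ∧ x + n * a = n ^ 2 * k + 2 * n * c + c := by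
  have hg : (n - 1) * n + n = n ^ 2 := by
    obtain ⟨m, rfl⟩ : ∃ m, n = m + 1 := ⟨n - 1, by omega⟩
    simp only [Nat.add_sub_cancel]
    ring
  generalize (n - 1) * n = g at hg
  constructor
  · intro hx
    have hsum : ∃ α β γ, x = α * g + β * n ^ 2 + γ * (n ^ 3 + 2 * n + 1) := by
      induction hx using AddSubmonoid.closure_induction with
      | mem x hx =>
        rcases hx with rfl | rfl | rfl
        · exact ⟨1, 0, 0, by ring⟩
        · exact ⟨0, 1, 0, by ring⟩
        · exact ⟨0, 0, 1, by ring⟩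
      | zero => exact ⟨0, 0, 0, by ring⟩
      | add x y _ _ hx hy =>
        obtain ⟨α, β, γ, rfl⟩ := hx
        obtain ⟨α', β', γ', rfl⟩ := hy
        exact ⟨α + α', β + β', γ + γ', by ring⟩
    obtain ⟨α, β, γ, rfl⟩ := hsum
    obtain ⟨q, c, hc, rfl⟩ : ∃ q c, c < n ∧ γ = n * q + c :=
      ⟨γ / n, γ % n, Nat.mod_lt _ hn, (Nat.div_add_mod _ _).symm⟩
    obtain ⟨t, a, ha, hA⟩ : ∃ t a, a < n ∧ α + q * (n - 1) = n * t + a :=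
      ⟨_, _, Nat.mod_lt _ hn, (Nat.div_add_mod _ _).symm⟩
    have hqn : q * (n - 1) + q = q * n := by
      obtain ⟨m, rfl⟩ : ∃ m, n = m + 1 := ⟨n - 1, by omega⟩
      simp only [Nat.add_sub_cancel]
      ring
    have hA' : α + q * n = n * t + a + q := by omega
    have hs : t + a ≤ α + β + q * (n ^ 2 + 3) := by nlinarith
    obtain ⟨s, hs⟩ := Nat.exists_eq_add_of_le hs
    refine ⟨a, c, s + a + c * n, ha, hc, by omega, ?_⟩
    zify at *
    linear_combination α * hg + (-n) * hA' + (n : ℤ) ^ 2 * hs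
  · rintro ⟨a, c, k, ha, hc, hk, h⟩
    obtain ⟨b, rfl⟩ := Nat.exists_eq_add_of_le hk
    have hx : x = a • g + b • n ^ 2 + c • (n ^ 3 + 2 * n + 1) := by
      simp only [smul_eq_mul]
      zify at *
      linear_combination h - a * hg
    rw [hx]
    refine add_mem (add_mem ?_ ?_) ?_ <;> refine nsmul_mem (AddSubmonoid.subset_closure ?_) _ <;>
      simp

theorem normalForm_injective {n a c k a' c' k' : ℕ} (ha : a < n) (hc : c < n) (ha' : a' < n)
    (hc' : c' < n)
    (h : n ^ 2 * k + 2 * n * c + c + n * a' = n ^ 2 * k' + 2 * n * c' + c' + n * a) :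
    (a, c, k) = (a', c', k') := by
  have hcc : c = c' := by
    have h2 := congrArg (· % n) (show n * (n * k + 2 * c + a') + c =
      n * (n * k' + 2 * c' + a) + c' by linarith)
    simpa only [Nat.mul_add_mod, Nat.mod_eq_of_lt hc, Nat.mod_eq_of_lt hc'] using h2
  subst hcc
  have h3 : n * k + a' = n * k' + a := by
    apply Nat.eq_of_mul_eq_mul_left (show 0 < n by omega)
    linarith
  have haa : a' = a := by
    have h2 := congrArg (· % n) h3
    simpa only [Nat.mul_add_mod, Nat.mod_eq_of_lt ha, Nat.mod_eq_of_lt ha'] using h2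
  subst haa
  have : k = k' := Nat.eq_of_mul_eq_mul_left (show 0 < n by omega) (by omega)
  rw [this]

/-- Family (v): for `n ≥ 3` and `d = n² + 1`, the semigroup generated by
`(n−1)·n`, `n²`, `n³ + 2n + 1` (singularity of type `(n−1,n)(n,(n+1)²)`) satisfies the
Borodzik–Livingston counting condition `R(j·d) = (j+1)(j+2)/2` for `0 ≤ j ≤ d−3`. -/
theorem counting_condition_family_v
    (n d : ℕ) (hn : 3 ≤ n) (hd : d = n ^ 2 + 1) :
    ∀ j : ℕ, j ≤ d - 3 →
      {x : ℕ | x ∈ AddSubmonoid.closure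
          ({(n - 1) * n, n ^ 2, n ^ 3 + 2 * n + 1} : Set ℕ) ∧
        x ≤ j * d}.ncard = (j + 1) * (j + 2) / 2 := by
  intro j hjd
  have hj : j + 2 ≤ n ^ 2 := by
    have : 3 ^ 2 ≤ n ^ 2 := Nat.pow_le_pow_left hn 2
    omega
  subst hd
  have hle : ∀ a c k : ℕ, c * n + a ≤ k → n * a ≤ n ^ 2 * k + 2 * n * c + c := by
    intro a c k h
    have h1 : n * a ≤ n * k := Nat.mul_le_mul_left _ (by omega)
    have h2 : n * k ≤ n ^ 2 * k := Nat.mul_le_mul_right _ (Nat.le_self_pow two_ne_zero n)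
    omega
  rw [← card_normalForms hj, ← Set.ncard_coe_finset]
  symm
  refine Set.ncard_congr
    (fun p _ => n ^ 2 * p.2.2 + 2 * n * p.2.1 + p.2.1 - n * p.1) ?_ ?_ ?_
  · rintro ⟨a, c, k⟩ h
    rw [Finset.mem_coe, mem_normalForms] at h
    obtain ⟨⟨ha, hc, -⟩, hk, h⟩ := h
    refine ⟨(mem_closure_iff_exists_normalForm (by omega) _).2
      ⟨a, c, k, ha, hc, hk, Nat.sub_add_cancel (hle a c k hk)⟩, ?_⟩
    exact Nat.sub_le_iff_le_add.2 h
  · rintro ⟨a, c, k⟩ ⟨a', c', k'⟩ h h' heq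
    rw [Finset.mem_coe, mem_normalForms] at h h'
    have h1 := hle a c k h.2.1
    have h2 := hle a' c' k' h'.2.1
    exact normalForm_injective h.1.1 h.1.2.1 h'.1.1 h'.1.2.1 (by dsimp only at heq; omega)
  · rintro x ⟨hx, hxj⟩
    obtain ⟨a, c, k, ha, hc, hk, h⟩ := (mem_closure_iff_exists_normalForm (by omega) x).1 hx
    refine ⟨(a, c, k), ?_, by dsimp only; omega⟩
    rw [Finset.mem_coe, mem_normalForms]
    refine ⟨⟨ha, hc, ?_⟩, hk, by omega⟩
    by_contra! hk2
    have h1 : n ^ 2 * (j + 2) ≤ n ^ 2 * k := Nat.mul_le_mul_left _ hk2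
    have h2 : n * a ≤ n * n := Nat.mul_le_mul_left _ ha.le
    nlinarith
end

section
/- Fix an integer n ≥ 2, and set d = 8n² + 4n + 1. Let Γ be the additive submonoid of ℕ generated by g0 = n·(4n+1), g1 = (4n+1)² and g2 = n·(4n+1)² + (2n+1)² (the semigroup of the singularity of type (n, 4n+1)(4n+1, (2n+1)²)), and let R(n') = #(Γ ∩ [0,n']). Then R(j·d) = (j+1)(j+2)/2 for every integer j with 0 ≤ j ≤ d−3. -/
open Finset in
/-- Triples `(a, b, c)` with `b < n` and `a * g₀ + b * g₁ + c * g₂ ≤ B`. -/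
def boundedTriples (g₀ g₁ g₂ n B : ℕ) : Finset (ℕ × ℕ × ℕ) :=
  (range (B + 1) ×ˢ range n ×ˢ range (B + 1)).filter
    fun t => t.1 * g₀ + t.2.1 * g₁ + t.2.2 * g₂ ≤ B

theorem mem_boundedTriples {g₀ g₁ g₂ n B : ℕ} (h₀ : 0 < g₀) (h₂ : 0 < g₂) {a b c : ℕ} :
    (a, b, c) ∈ boundedTriples g₀ g₁ g₂ n B ↔ b < n ∧ a * g₀ + b * g₁ + c * g₂ ≤ B := by
  simp only [boundedTriples, Finset.mem_filter, Finset.mem_product, Finset.mem_range]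
  constructor
  · tauto
  · rintro ⟨hb, h⟩
    have := Nat.le_mul_of_pos_right a h₀
    have := Nat.le_mul_of_pos_right c h₂
    exact ⟨⟨by omega, hb, by omega⟩, h⟩

/-- Split the triples according to whether `c = 0`, or `a = 0 < c`, or `a, c > 0`. -/
theorem card_boundedTriples {g₀ g₂ : ℕ} (h₀ : 0 < g₀) (h₂ : 0 < g₂) (g₁ n B : ℕ) :
    (boundedTriples g₀ g₁ g₂ n B).card =
      ∑ b ∈ Finset.range n, ((B + g₀ - b * g₁) / g₀ + (B - b * g₁) / g₂) +
        if g₀ + g₂ ≤ B then (boundedTriples g₀ g₁ g₂ n (B - (g₀ + g₂))).card else 0 := by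
  classical
  have hc : ((boundedTriples g₀ g₁ g₂ n B).filter fun t => t.2.2 = 0).card =
      ∑ b ∈ Finset.range n, (B + g₀ - b * g₁) / g₀ := by
    rw [← Finset.sum_congr rfl fun b _ => Finset.card_range ((B + g₀ - b * g₁) / g₀),
      ← Finset.card_sigma]
    refine Finset.card_nbij' (fun t => ⟨t.2.1, t.1⟩) (fun s => (s.2, s.1, 0)) ?_ ?_ ?_ ?_
    · rintro ⟨a, b, c⟩ h
      simp only [Finset.coe_filter, Set.mem_ofPred_eq, mem_boundedTriples h₀ h₂] at h
      simp only [Finset.coe_sigma, Finset.coe_range, Set.mem_sigma_iff, Set.mem_Iio]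
      refine ⟨h.1.1, ?_⟩
      rw [← Nat.succ_le_iff, Nat.le_div_iff_mul_le h₀, Nat.succ_mul]
      have := h.1.2
      omega
    · rintro ⟨b, a⟩ h
      simp only [Finset.coe_sigma, Finset.coe_range, Set.mem_sigma_iff, Set.mem_Iio] at h
      simp only [Finset.coe_filter, Set.mem_ofPred_eq, mem_boundedTriples h₀ h₂]
      obtain ⟨hb, ha⟩ := h
      rw [← Nat.succ_le_iff, Nat.le_div_iff_mul_le h₀, Nat.succ_mul] at ha
      exact ⟨⟨hb, by omega⟩, trivial⟩
    · rintro ⟨a, b, c⟩ h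
      simp only [Finset.coe_filter, Set.mem_ofPred_eq] at h
      simp [h.2]
    · rintro ⟨b, a⟩ _
      rfl
  have ha : (((boundedTriples g₀ g₁ g₂ n B).filter fun t => ¬ t.2.2 = 0).filter
      fun t => t.1 = 0).card = ∑ b ∈ Finset.range n, (B - b * g₁) / g₂ := by
    rw [← Finset.sum_congr rfl fun b _ => Finset.card_range ((B - b * g₁) / g₂),
      ← Finset.card_sigma]
    refine Finset.card_nbij' (fun t => ⟨t.2.1, t.2.2 - 1⟩) (fun s => (0, s.1, s.2 + 1)) ?_ ?_ ?_ ?_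
    · rintro ⟨a, b, c⟩ h
      simp only [Finset.coe_filter, Finset.mem_filter, Set.mem_ofPred_eq,
        mem_boundedTriples h₀ h₂] at h
      simp only [Finset.coe_sigma, Finset.coe_range, Set.mem_sigma_iff, Set.mem_Iio]
      obtain ⟨⟨⟨hb, h⟩, hc⟩, rfl⟩ := h
      refine ⟨hb, ?_⟩
      rw [← Nat.succ_le_iff, Nat.le_div_iff_mul_le h₂, Nat.succ_eq_add_one,
        Nat.sub_add_cancel (Nat.pos_of_ne_zero hc)]
      omega
    · rintro ⟨b, c⟩ h
      simp only [Finset.coe_sigma, Finset.coe_range, Set.mem_sigma_iff, Set.mem_Iio] at h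
      simp only [Finset.coe_filter, Finset.mem_filter, Set.mem_ofPred_eq,
        mem_boundedTriples h₀ h₂]
      obtain ⟨hb, hc⟩ := h
      rw [← Nat.succ_le_iff, Nat.le_div_iff_mul_le h₂, Nat.succ_eq_add_one] at hc
      have : 0 < (c + 1) * g₂ := by positivity
      exact ⟨⟨⟨hb, by omega⟩, by omega⟩, trivial⟩
    · rintro ⟨a, b, c⟩ h
      simp only [Finset.coe_filter, Finset.mem_filter, Set.mem_ofPred_eq] at h
      simp [h.2, Nat.sub_add_cancel (Nat.pos_of_ne_zero h.1.2)]
    · rintro ⟨b, a⟩ _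
      rfl
  have hac : (((boundedTriples g₀ g₁ g₂ n B).filter fun t => ¬ t.2.2 = 0).filter
      fun t => ¬ t.1 = 0).card =
        if g₀ + g₂ ≤ B then (boundedTriples g₀ g₁ g₂ n (B - (g₀ + g₂))).card else 0 := by
    split_ifs with hB
    · refine Finset.card_nbij' (fun t => (t.1 - 1, t.2.1, t.2.2 - 1))
        (fun t => (t.1 + 1, t.2.1, t.2.2 + 1)) ?_ ?_ ?_ ?_
      · rintro ⟨a, b, c⟩ h
        simp only [Finset.coe_filter, Finset.mem_filter, Set.mem_ofPred_eq,
          mem_boundedTriples h₀ h₂] at h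
        simp only [Finset.mem_coe, mem_boundedTriples h₀ h₂]
        obtain ⟨⟨⟨hb, h⟩, hc⟩, ha⟩ := h
        obtain ⟨a, rfl⟩ := Nat.exists_eq_succ_of_ne_zero ha
        obtain ⟨c, rfl⟩ := Nat.exists_eq_succ_of_ne_zero hc
        simp only [Nat.succ_mul, Nat.succ_sub_one] at h ⊢
        exact ⟨hb, by omega⟩
      · rintro ⟨a, b, c⟩ h
        simp only [Finset.mem_coe, mem_boundedTriples h₀ h₂] at h
        simp only [Finset.coe_filter, Finset.mem_filter, Set.mem_ofPred_eq,
          mem_boundedTriples h₀ h₂, add_mul, one_mul]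
        exact ⟨⟨⟨h.1, by omega⟩, by omega⟩, by omega⟩
      · rintro ⟨a, b, c⟩ h
        simp only [Finset.coe_filter, Finset.mem_filter, Set.mem_ofPred_eq] at h
        simp [Nat.sub_add_cancel (Nat.pos_of_ne_zero h.1.2),
          Nat.sub_add_cancel (Nat.pos_of_ne_zero h.2)]
      · rintro ⟨a, b, c⟩ _
        rfl
    · rw [Finset.card_eq_zero, Finset.eq_empty_iff_forall_notMem]
      rintro ⟨a, b, c⟩ h
      simp only [Finset.mem_filter, mem_boundedTriples h₀ h₂] at h
      obtain ⟨⟨⟨hb, h⟩, hc⟩, ha⟩ := h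
      have := Nat.le_mul_of_pos_left g₀ (Nat.pos_of_ne_zero ha)
      have := Nat.le_mul_of_pos_left g₂ (Nat.pos_of_ne_zero hc)
      omega
  rw [← Finset.card_filter_add_card_filter_not (s := boundedTriples g₀ g₁ g₂ n B)
      (fun t => t.2.2 = 0),
    ← Finset.card_filter_add_card_filter_not
      (s := (boundedTriples g₀ g₁ g₂ n B).filter fun t => ¬ t.2.2 = 0) (fun t => t.1 = 0),
    hc, ha, hac, Finset.sum_add_distrib, add_assoc]

theorem sum_range_sub_ediv (n : ℕ) (hn : 0 < n) (y : ℤ) :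
    ∑ b ∈ Finset.range n, (y - b) / (n : ℤ) = y - n + 1 := by
  have hn' : (0 : ℤ) < n := by exact_mod_cast hn
  set q := y / n
  set r := y % n
  have hy : y = n * q + r := (Int.mul_ediv_add_emod y n).symm
  have hr0 : 0 ≤ r := Int.emod_nonneg _ hn'.ne'
  have hr1 : r < n := Int.emod_lt_of_pos _ hn'
  have key : ∀ N : ℕ, N ≤ n →
      ∑ b ∈ Finset.range N, (y - b) / (n : ℤ) = N * q - max 0 (N - 1 - r) := by
    intro N
    induction N with
    | zero => intro _; simp; omega
    | succ N ih =>
      intro hN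
      rw [Finset.sum_range_succ, ih (by omega)]
      have h1 : (y - N) / (n : ℤ) = q + (r - N) / n := by
        rw [hy, show n * q + r - (N : ℤ) = r - N + n * q by ring,
          Int.add_mul_ediv_left _ _ hn'.ne', add_comm]
      rw [h1]
      push_cast
      by_cases h : (N : ℤ) ≤ r
      · rw [Int.ediv_eq_zero_of_lt (by omega) (by omega), max_eq_left (by omega),
          max_eq_left (by omega)]
        ring
      · have : (r - N) / (n : ℤ) = -1 := by
          rw [Int.ediv_eq_iff_of_pos hn']
          constructor <;> omega
        rw [this, max_eq_right (by omega), max_eq_right (by omega)]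
        ring
  rw [key n le_rfl, max_eq_right (by omega), hy]
  ring

theorem sum_range_ediv_four_mul_add_one (n : ℕ) (j : ℤ) :
    ∑ b ∈ Finset.range n, (2 * j - 1 - 4 * b) / (4 * n + 1 : ℤ) +
      (2 * n + 1) * j / (4 * n + 1) = j - n := by
  set m : ℤ := 4 * n + 1 with hm
  have hm0 : 0 < m := by omega
  set q := j / m
  set i := j % m
  have hj : j = m * q + i := (Int.mul_ediv_add_emod j m).symm
  have hi0 : 0 ≤ i := Int.emod_nonneg _ hm0.ne'
  have hi1 : i < m := Int.emod_lt_of_pos _ hm0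
  have key : ∀ N : ℕ, N ≤ n → ∑ b ∈ Finset.range N, (2 * j - 1 - 4 * b) / m =
      N * (2 * q) + max 0 (min (N : ℤ) ((i - 2 * n + 1) / 2)) - max 0 (N - (i + 1) / 2) := by
    intro N
    induction N with
    | zero => intro _; simp; omega
    | succ N ih =>
      intro hN
      rw [Finset.sum_range_succ, ih (by omega)]
      have h1 : (2 * j - 1 - 4 * N) / m = 2 * q + (2 * i - 1 - 4 * N) / m := by
        rw [hj, show 2 * (m * q + i) - 1 - 4 * (N : ℤ) = 2 * i - 1 - 4 * N + m * (2 * q) by ring,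
          Int.add_mul_ediv_left _ _ hm0.ne', add_comm]
      have h2 : (2 * i - 1 - 4 * N) / m =
          if i ≤ 2 * N then -1 else if 2 * N + 2 * n + 1 ≤ i then 1 else 0 := by
        rw [Int.ediv_eq_iff_of_pos hm0]
        split_ifs <;> constructor <;> omega
      rw [h1, h2]
      push_cast
      rw [add_mul]
      generalize (N : ℤ) * (2 * q) = z
      split_ifs <;> omega
  have h3 : (2 * n + 1) * j / m = (2 * n + 1) * q + i / 2 := by
    have : (2 * n + 1) * i / m = i / 2 := by
      rw [Int.ediv_eq_iff_of_pos hm0]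
      obtain h | h := Int.emod_two_eq_zero_or_one i <;>
      · obtain ⟨e, he⟩ : ∃ e, e = i / 2 := ⟨_, rfl⟩
        have : i = 2 * e + i % 2 := by omega
        rw [← he, this, h, hm]
        constructor <;> nlinarith
    rw [hj, show (2 * n + 1) * (m * q + i) = (2 * n + 1) * i + m * ((2 * n + 1) * q) by ring,
      Int.add_mul_ediv_left _ _ hm0.ne', this, add_comm]
  rw [key n le_rfl, h3]
  have h4 : j = n * (2 * q) + (2 * n + 1) * q + i := by rw [hj, hm]; ring
  rw [h4]
  generalize (n : ℤ) * (2 * q) = z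
  generalize (2 * (n : ℤ) + 1) * q = w
  omega

theorem mem_closure_triple_iff_exists_lt {n m g : ℕ} (hn : 0 < n) {x : ℕ} :
    x ∈ AddSubmonoid.closure ({n * m, m ^ 2, g} : Set ℕ) ↔
      ∃ a b c, b < n ∧ a * (n * m) + b * m ^ 2 + c * g = x := by
  constructor
  · intro hx
    have : ∃ a b c, a * (n * m) + b * m ^ 2 + c * g = x := by
      induction hx using AddSubmonoid.closure_induction with
      | mem x hx =>
        obtain rfl | rfl | rfl := hx
        · exact ⟨1, 0, 0, by ring⟩
        · exact ⟨0, 1, 0, by ring⟩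
        · exact ⟨0, 0, 1, by ring⟩
      | zero => exact ⟨0, 0, 0, by ring⟩
      | add x y _ _ hx hy =>
        obtain ⟨a, b, c, rfl⟩ := hx
        obtain ⟨a', b', c', rfl⟩ := hy
        exact ⟨a + a', b + b', c + c', by ring⟩
    obtain ⟨a, b, c, rfl⟩ := this
    refine ⟨a + m * (b / n), b % n, c, Nat.mod_lt _ hn, ?_⟩
    conv_rhs => rw [← Nat.mod_add_div b n]
    ring
  · rintro ⟨a, b, c, _, rfl⟩
    have mem : ∀ y ∈ ({n * m, m ^ 2, g} : Set ℕ), ∀ k : ℕ,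
        k * y ∈ AddSubmonoid.closure ({n * m, m ^ 2, g} : Set ℕ) := fun y hy k => by
      rw [← smul_eq_mul]
      exact AddSubmonoid.nsmul_mem _ (AddSubmonoid.subset_closure hy) k
    exact add_mem (add_mem (mem _ (by simp) a) (mem _ (by simp) b)) (mem _ (by simp) c)

theorem eq_of_dvd_sub_of_lt {a b m : ℕ} (ha : a < m) (hb : b < m)
    (h : (m : ℤ) ∣ a - b) : a = b :=
  Nat.ModEq.eq_of_lt_of_lt ((Nat.modEq_iff_dvd.2 h).symm) ha hb

theorem ncard_closure_le_eq_card_boundedTriples {n B : ℕ} (hn : 0 < n)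
    (hB : B < (4 * n + 1) * (n * (4 * n + 1) ^ 2 + (2 * n + 1) ^ 2)) :
    {x : ℕ | x ∈ AddSubmonoid.closure
        ({n * (4 * n + 1), (4 * n + 1) ^ 2,
          n * (4 * n + 1) ^ 2 + (2 * n + 1) ^ 2} : Set ℕ) ∧ x ≤ B}.ncard =
      (boundedTriples (n * (4 * n + 1)) ((4 * n + 1) ^ 2)
        (n * (4 * n + 1) ^ 2 + (2 * n + 1) ^ 2) n B).card := by
  set m := 4 * n + 1 with hm
  set g := n * m ^ 2 + (2 * n + 1) ^ 2 with hg
  have h₀ : 0 < n * m := by positivity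
  have h₂ : 0 < g := by positivity
  have himage : {x : ℕ | x ∈ AddSubmonoid.closure ({n * m, m ^ 2, g} : Set ℕ) ∧ x ≤ B} =
      (fun t : ℕ × ℕ × ℕ => t.1 * (n * m) + t.2.1 * m ^ 2 + t.2.2 * g) ''
        (boundedTriples (n * m) (m ^ 2) g n B : Set (ℕ × ℕ × ℕ)) := by
    ext x
    simp only [Set.mem_ofPred_eq, mem_closure_triple_iff_exists_lt hn, Set.mem_image,
      Finset.mem_coe, Prod.exists, mem_boundedTriples h₀ h₂]
    constructor
    · rintro ⟨⟨a, b, c, hb, rfl⟩, hx⟩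
      exact ⟨a, b, c, ⟨hb, hx⟩, rfl⟩
    · rintro ⟨a, b, c, ⟨hb, hx⟩, rfl⟩
      exact ⟨⟨a, b, c, hb, rfl⟩, hx⟩
  rw [himage, Set.InjOn.ncard_image, Set.ncard_coe_finset]
  have hlt : ∀ {a b c : ℕ}, a * (n * m) + b * m ^ 2 + c * g ≤ B → c < m := fun {a b c} h =>
    lt_of_mul_lt_mul_right (by omega : c * g < m * g) h₂.le
  rintro ⟨a, b, c⟩ h ⟨a', b', c'⟩ h' heq
  rw [Finset.mem_coe, mem_boundedTriples h₀ h₂] at h h'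
  dsimp only at heq
  have heq' : (a * (n * m) + b * m ^ 2 + c * g : ℤ) = a' * (n * m) + b' * m ^ 2 + c' * g := by
    exact_mod_cast heq
  have hmz : (m : ℤ) = 4 * n + 1 := by simp [hm]
  have hc : c = c' := by
    refine eq_of_dvd_sub_of_lt (hlt h.2) (hlt h'.2) ?_
    have hcop : IsCoprime (m : ℤ) ((2 * n + 1) ^ 2) :=
      IsCoprime.pow_right ⟨-1, 2, by rw [hmz]; ring⟩
    refine hcop.dvd_of_dvd_mul_right
      ⟨(a' - a) * n + (b' - b) * m + (c' - c) * (n * m), ?_⟩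
    rw [hg] at heq'
    push_cast at heq'
    linear_combination heq'
  subst hc
  have heq₂ : (a * n + b * m : ℤ) = a' * n + b' * m :=
    mul_right_cancel₀ (b := (m : ℤ)) (by omega) (by linear_combination heq')
  have hb : b = b' :=
    eq_of_dvd_sub_of_lt h.1 h'.1 ⟨a' - a - 4 * (b - b'), by
      rw [hmz] at heq₂
      linear_combination heq₂⟩
  subst hb
  have ha : (a : ℤ) = a' :=
    mul_right_cancel₀ (b := (n : ℤ)) (by omega) (by linear_combination heq₂)
  rw [Nat.cast_inj.1 ha]

theorem sum_range_sub_four_mul {n j : ℕ} (hj : j < 2 * n) :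
    2 * ∑ b ∈ Finset.range n, (2 * j + 1 - 4 * b) = (j + 1) * (j + 2) := by
  have key : ∀ N : ℕ, 2 * N ≤ j + 2 →
      (∑ b ∈ Finset.range N, (2 * j + 1 - 4 * b : ℕ) : ℕ) = (N : ℤ) * (2 * j + 3 - 2 * N) := by
    intro N
    induction N with
    | zero => simp
    | succ N ih =>
      intro hN
      rw [Finset.sum_range_succ, Nat.cast_add, ih (by omega), Nat.cast_sub (by omega)]
      push_cast
      ring
  have hsub : Finset.range (j / 2 + 1) ⊆ Finset.range n := Finset.range_subset_range.2 (by omega)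
  rw [← Finset.sum_subset hsub fun b _ hb => by rw [Finset.mem_range] at hb; omega]
  zify
  rw [← Nat.cast_sum, key _ (by omega)]
  obtain ⟨e, rfl | rfl⟩ := Nat.even_or_odd' j
  · rw [Nat.mul_div_cancel_left _ two_pos]
    push_cast
    ring
  · rw [show (2 * e + 1) / 2 = e by omega]
    push_cast
    ring

theorem sum_div_of_lt {n d j : ℕ} (hd : d = 8 * n ^ 2 + 4 * n + 1) (hj : j < 2 * n) :
    2 * ∑ b ∈ Finset.range n,
      ((j * d + n * (4 * n + 1) - b * (4 * n + 1) ^ 2) / (n * (4 * n + 1)) +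
        (j * d - b * (4 * n + 1) ^ 2) / (n * (4 * n + 1) ^ 2 + (2 * n + 1) ^ 2)) =
      (j + 1) * (j + 2) := by
  rw [← sum_range_sub_four_mul hj]
  congr 1
  refine Finset.sum_congr rfl fun b hb => ?_
  rw [Finset.mem_range] at hb
  have h₂ : j * d < n * (4 * n + 1) ^ 2 + (2 * n + 1) ^ 2 := by
    rw [hd]
    nlinarith [Nat.mul_le_mul_right (8 * n ^ 2 + 4 * n + 1) (show j + 1 ≤ 2 * n by omega)]
  rw [Nat.div_eq_of_lt (a := j * d - _) (by omega), add_zero]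
  by_cases hbj : 2 * b ≤ j
  · obtain ⟨e, rfl⟩ := Nat.exists_eq_add_of_le hbj
    have h1 : (2 * b + e) * d + n * (4 * n + 1) - b * (4 * n + 1) ^ 2 =
        (e * (2 * n + 1) + b) + n * (4 * n + 1) * (2 * e + 1) := by
      rw [hd]
      apply Nat.sub_eq_of_eq_add
      ring
    have h2 : e * (2 * n + 1) + b < n * (4 * n + 1) := by nlinarith
    rw [h1, Nat.add_mul_div_left _ _ (by omega), Nat.div_eq_of_lt h2]
    omega
  · rw [show 2 * j + 1 - 4 * b = 0 by omega, Nat.div_eq_of_lt]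
    have h0 : 0 < n * (4 * n + 1) := Nat.mul_pos (by omega) (by omega)
    suffices j * d < b * (4 * n + 1) ^ 2 by omega
    rw [hd]
    nlinarith [Nat.mul_le_mul_right ((4 * n + 1) ^ 2) (show j + 1 ≤ 2 * b by omega)]

theorem sum_div_of_le {n d j : ℕ} (hn : 2 ≤ n) (hd : d = 8 * n ^ 2 + 4 * n + 1)
    (hj : 2 * n ≤ j) (hjd : j ≤ d - 3) :
    ∑ b ∈ Finset.range n,
      ((j * d + n * (4 * n + 1) - b * (4 * n + 1) ^ 2) / (n * (4 * n + 1)) +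
        (j * d - b * (4 * n + 1) ^ 2) / (n * (4 * n + 1) ^ 2 + (2 * n + 1) ^ 2)) =
      (2 * n + 1) * (j + 1 - n) := by
  have hnz : (2 : ℤ) ≤ n := by exact_mod_cast hn
  have hjz : 2 * (n : ℤ) ≤ j := by exact_mod_cast hj
  have hdz : (d : ℤ) = 8 * n ^ 2 + 4 * n + 1 := by exact_mod_cast hd
  have hjdz : (j : ℤ) ≤ 8 * n ^ 2 + 4 * n - 2 := by
    rw [← sub_nonneg]
    have : 3 ≤ d := by rw [hd]; nlinarith
    zify [this] at hjd
    linarith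
  have hterm : ∀ b ∈ Finset.range n,
      (((j * d + n * (4 * n + 1) - b * (4 * n + 1) ^ 2) / (n * (4 * n + 1)) +
        (j * d - b * (4 * n + 1) ^ 2) / (n * (4 * n + 1) ^ 2 + (2 * n + 1) ^ 2) : ℕ) : ℤ) =
      (1 + 2 * j - 4 * b) + ((2 * n + 1) * j / (4 * n + 1) - b) / (n : ℤ) +
        (2 * j - 1 - 4 * b) / (4 * n + 1 : ℤ) := by
    intro b hb
    rw [Finset.mem_range] at hb
    have hbz : (b : ℤ) + 1 ≤ n := by exact_mod_cast hb
    have hle : b * (4 * n + 1) ^ 2 ≤ j * d := by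
      rw [hd]
      nlinarith [Nat.mul_le_mul_right (8 * n ^ 2 + 4 * n + 1) hj,
        Nat.mul_le_mul_right ((4 * n + 1) ^ 2) (show b + 1 ≤ n by omega)]
    push_cast [Nat.cast_sub hle, Nat.cast_sub (Nat.le_add_right_of_le hle), hdz]
    congr 1
    · rw [show (j * (8 * n ^ 2 + 4 * n + 1) + n * (4 * n + 1) - b * (4 * n + 1) ^ 2 : ℤ) =
          ((2 * n + 1) * j - b * (4 * n + 1)) + n * (4 * n + 1) * (1 + 2 * j - 4 * b) by ring,
        Int.add_mul_ediv_left _ _ (by positivity), mul_comm (n : ℤ) (4 * n + 1),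
        ← Int.ediv_ediv_of_nonneg (by positivity), sub_eq_add_neg ((2 * (n : ℤ) + 1) * j),
        ← neg_mul, Int.add_mul_ediv_right _ _ (by positivity)]
      ring_nf
    · set q := (2 * j - 1 - 4 * b) / (4 * n + 1 : ℤ) with hq
      have hm : (0 : ℤ) < 4 * n + 1 := by positivity
      have h1 : q * (4 * n + 1) ≤ 2 * j - 1 - 4 * b := Int.ediv_mul_le _ hm.ne'
      have h2 : 2 * j - 1 - 4 * b < (q + 1) * (4 * n + 1) := Int.lt_ediv_add_one_mul_self _ hm
      have hq0 : 0 ≤ q := Int.ediv_nonneg (by omega) hm.le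
      have hq1 : q ≤ 4 * n := by
        rw [← Int.lt_add_one_iff]
        refine lt_of_mul_lt_mul_right (h1.trans_lt ?_) hm.le
        nlinarith
      rw [Int.ediv_eq_iff_of_pos (by positivity)]
      constructor
      · nlinarith [mul_le_mul_of_nonneg_right h1
          (show (0 : ℤ) ≤ 8 * n ^ 2 + 4 * n + 1 by positivity)]
      · nlinarith [mul_le_mul_of_nonneg_right (Int.add_one_le_iff.2 h2)
          (show (0 : ℤ) ≤ 8 * n ^ 2 + 4 * n + 1 by positivity)]
  have hlin : ∀ N : ℕ, ∑ b ∈ Finset.range N, (1 + 2 * j - 4 * b : ℤ) =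
      N * (1 + 2 * j) - 2 * N * (N - 1) := by
    intro N
    induction N with
    | zero => simp
    | succ N ih =>
      rw [Finset.sum_range_succ, ih]
      push_cast
      ring
  apply Nat.cast_injective (R := ℤ)
  rw [Nat.cast_sum, Nat.cast_mul, Nat.cast_sub (by omega), Finset.sum_congr rfl hterm,
    Finset.sum_add_distrib, Finset.sum_add_distrib, hlin, sum_range_sub_ediv n (by omega)]
  push_cast
  linear_combination sum_range_ediv_four_mul_add_one n j

theorem card_boundedTriples_mul {n d : ℕ} (hn : 2 ≤ n) (hd : d = 8 * n ^ 2 + 4 * n + 1) (j : ℕ)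
    (hj : j ≤ d - 3) :
    2 * (boundedTriples (n * (4 * n + 1)) ((4 * n + 1) ^ 2)
        (n * (4 * n + 1) ^ 2 + (2 * n + 1) ^ 2) n (j * d)).card = (j + 1) * (j + 2) := by
  have hsum : n * (4 * n + 1) + (n * (4 * n + 1) ^ 2 + (2 * n + 1) ^ 2) = (2 * n + 1) * d := by
    rw [hd]
    ring
  have hd0 : 0 < d := by omega
  induction j using Nat.strong_induction_on with
  | _ j ih =>
    rw [card_boundedTriples (by positivity) (by positivity), hsum, ← Nat.sub_mul, mul_add]
    simp only [Nat.mul_le_mul_right_iff hd0]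
    obtain hlt | hle := lt_or_ge j (2 * n)
    · rw [sum_div_of_lt hd hlt, if_neg (by omega)]
      ring
    · rw [sum_div_of_le hn hd hle hj]
      split_ifs with h
      · rw [ih _ (by omega) (by omega)]
        obtain ⟨e, rfl⟩ := Nat.exists_eq_add_of_le h
        rw [Nat.add_sub_cancel_left, show 2 * n + 1 + e + 1 - n = n + 2 + e by omega]
        ring
      · obtain rfl : j = 2 * n := by omega
        rw [show 2 * n + 1 - n = n + 1 by omega]
        ring

/-- Family (vi): for `n ≥ 2` and `d = 8n² + 4n + 1`, the semigroup generated by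
`n·(4n+1)`, `(4n+1)²`, `n·(4n+1)² + (2n+1)²` (singularity of type
`(n,4n+1)(4n+1,(2n+1)²)`) satisfies the Borodzik–Livingston counting condition
`R(j·d) = (j+1)(j+2)/2` for `0 ≤ j ≤ d−3`. -/
theorem counting_condition_family_vi
    (n d : ℕ) (hn : 2 ≤ n) (hd : d = 8 * n ^ 2 + 4 * n + 1) :
    ∀ j : ℕ, j ≤ d - 3 →
      {x : ℕ | x ∈ AddSubmonoid.closure
          ({n * (4 * n + 1), (4 * n + 1) ^ 2,
            n * (4 * n + 1) ^ 2 + (2 * n + 1) ^ 2} : Set ℕ) ∧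
        x ≤ j * d}.ncard = (j + 1) * (j + 2) / 2 := by
  intro j hj
  have hB : j * d < (4 * n + 1) * (n * (4 * n + 1) ^ 2 + (2 * n + 1) ^ 2) := by
    refine (Nat.mul_le_mul_right d hj).trans_lt ?_
    obtain ⟨e, rfl⟩ : ∃ e, d = e + 3 := ⟨d - 3, by omega⟩
    rw [Nat.add_sub_cancel]
    obtain rfl : e = 8 * n ^ 2 + 4 * n - 2 := by omega
    zify [show 2 ≤ 8 * n ^ 2 + 4 * n by omega]
    nlinarith
  rw [ncard_closure_le_eq_card_boundedTriples (by omega) hB]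
  have := card_boundedTriples_mul hn hd j hj
  omega
end

section
/- Fix an integer k ≥ 2, and set d = F(4k+2). Let Γ be the additive submonoid of ℕ generated by g0 = F(4k), g1 = F(4k+4) and g2 = 3·(F(4k)/3)·(F(4k+4)/3) + 1 (the semigroup of the singularity of type (F(4k)/3, F(4k+4)/3)(3, 1); here the divisions are exact since 3 divides F(4k) and F(4k+4)), and let R(n) = #(Γ ∩ [0,n]). Then R(j·d) = (j+1)(j+2)/2 for every integer j with 0 ≤ j ≤ d−3. -/
lemma fib_four_mul_add_one_sq (k : ℕ) :
    Nat.fib (4 * k + 1) ^ 2 =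
      Nat.fib (4 * k) * Nat.fib (4 * k + 1) + Nat.fib (4 * k) ^ 2 + 1 := by
  induction k with
  | zero => simp
  | succ k ih =>
    have h2 := Nat.fib_add_two (n := 4 * k)
    have h3 := Nat.fib_add_two (n := 4 * k + 1)
    have h4 := Nat.fib_add_two (n := 4 * k + 2)
    have h5 := Nat.fib_add_two (n := 4 * k + 3)
    simp only [show 4 * (k + 1) = 4 * k + 4 by ring, add_assoc, Nat.reduceAdd] at *
    rw [h5, h4, h3, h2]
    linarith

lemma coprime_of_nine_mul_add_one {a b d : ℕ} (hab : a + b = d)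
    (hd : 9 * (a * b) + 1 = d * d) : Nat.Coprime a b := by
  subst hab
  rw [← Nat.isCoprime_iff_coprime]
  refine ⟨a - 7 * b, b, ?_⟩
  zify at hd
  linarith

lemma three_mul_dvd_of_dvd_mul {a b d J : ℕ} (hd : 9 * (a * b) + 1 = d * d)
    (h : 3 * a ∣ J * d) : 3 * a ∣ J := by
  refine Nat.Coprime.dvd_of_dvd_mul_right ?_ h
  rw [← Nat.isCoprime_iff_coprime]
  refine ⟨-(3 * b), d, ?_⟩
  zify at hd
  push_cast
  linarith

/-- Lattice points on the axes of the triangle `3 a u + 3 b v ≤ J d`. -/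
lemma div_add_div_add_one {a b d J : ℕ} (ha : 0 < a) (hlt : a < b) (hab : a + b = d)
    (hd : 9 * (a * b) + 1 = d * d) (hJ : J < d) :
    J * d / (3 * a) + J * d / (3 * b) + 1 = 3 * J + if 3 * a ∣ J then 1 else 0 := by
  have hy := Nat.div_add_mod (J * d) (3 * a)
  have hx := Nat.div_add_mod (J * d) (3 * b)
  have hylt := Nat.mod_lt (J * d) (show 0 < 3 * a by omega)
  have hxlt := Nat.mod_lt (J * d) (show 0 < 3 * b by omega)
  have hydvd : J * d % (3 * a) = 0 → 3 * a ∣ J := fun h =>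
    three_mul_dvd_of_dvd_mul hd (Nat.dvd_of_mod_eq_zero h)
  have hydvd' : 3 * a ∣ J → J * d % (3 * a) = 0 := fun h =>
    Nat.mod_eq_zero_of_dvd (h.mul_right d)
  have hxdvd : J * d % (3 * b) = 0 → 3 * a ∣ J := fun h => by
    have h1 : 3 * b ∣ J := three_mul_dvd_of_dvd_mul (by rwa [mul_comm b a])
      (Nat.dvd_of_mod_eq_zero h)
    have h2 := Nat.eq_zero_of_dvd_of_lt h1 (by omega)
    simp [h2]
  generalize J * d / (3 * a) = q at *
  generalize J * d / (3 * b) = p at *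
  generalize J * d % (3 * a) = y at *
  generalize J * d % (3 * b) = x at *
  have key : 3 * (a * b) * (p + q) + (b * y + a * x) = 3 * (a * b) * (3 * J) + J := by
    have h1 : b * (3 * a * q + y) + a * (3 * b * p + x) = J * (d * d) := by
      rw [hy, hx, ← hab]; ring
    rw [← hd] at h1
    linarith
  have hby : b * y + b ≤ 3 * (a * b) := by nlinarith
  have hax : a * x + a ≤ 3 * (a * b) := by nlinarith
  have hdle : d ≤ 3 * (a * b) := by nlinarith
  have hM : 0 < 3 * (a * b) := by omega
  generalize 3 * (a * b) = M at *
  have hle : p + q ≤ 3 * J := by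
    by_contra! h
    have : M * (3 * J + 1) ≤ M * (p + q) := Nat.mul_le_mul_left _ h
    rw [mul_add] at this
    omega
  have hge : 3 * J ≤ p + q + 1 := by
    by_contra! h
    have : M * (p + q + 2) ≤ M * (3 * J) := Nat.mul_le_mul_left _ h
    rw [mul_add] at this
    omega
  split_ifs with h
  · have hy0 := hydvd' h
    subst hy0
    by_contra! hne
    have : M * (p + q + 1) = M * (3 * J) := by congr 1; omega
    rw [mul_add] at this
    omega
  · by_contra! hne
    have h3 : p + q = 3 * J := by omega
    rw [h3] at key
    have h4 : y ≠ 0 := fun h0 => h (hydvd h0)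
    have h5 : x ≠ 0 := fun h0 => h (hxdvd h0)
    have h6 : b * 1 ≤ b * y := Nat.mul_le_mul_left _ (by omega)
    have h7 : a * 1 ≤ a * x := Nat.mul_le_mul_left _ (by omega)
    omega

/-- The lattice points of the triangle `a u + b v ≤ n` in the first quadrant. -/
def trianglePoints (a b n : ℕ) : Finset (ℕ × ℕ) :=
  (Finset.range (n + 1) ×ˢ Finset.range (n + 1)).filter fun w => a * w.1 + b * w.2 ≤ n

lemma mem_trianglePoints {a b n : ℕ} (ha : 0 < a) (hb : 0 < b) {w : ℕ × ℕ} :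
    w ∈ trianglePoints a b n ↔ a * w.1 + b * w.2 ≤ n := by
  simp only [trianglePoints, Finset.mem_filter, Finset.mem_product, Finset.mem_range,
    and_iff_right_iff_imp]
  intro h
  constructor <;> nlinarith [Nat.zero_le (a * w.1), Nat.zero_le (b * w.2)]

lemma card_trianglePoints {a b n : ℕ} (ha : 0 < a) (hb : 0 < b) :
    (trianglePoints a b n).card =
      (if n < a + b then 0 else (trianglePoints a b (n - (a + b))).card) +
        (n / a + n / b + 1) := by
  have hpos : ((trianglePoints a b n).filter fun w => 1 ≤ w.1 ∧ 1 ≤ w.2).card =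
      if n < a + b then 0 else (trianglePoints a b (n - (a + b))).card := by
    split_ifs with h
    · rw [Finset.card_eq_zero, Finset.filter_eq_empty_iff]
      rintro ⟨u, v⟩ hw ⟨h1, h2⟩
      rw [mem_trianglePoints ha hb] at hw
      dsimp only at *
      nlinarith
    · symm
      refine Finset.card_nbij' (fun w => (w.1 + 1, w.2 + 1)) (fun w => (w.1 - 1, w.2 - 1))
        ?_ ?_ ?_ ?_
      · rintro ⟨u, v⟩ hw
        simp only [Finset.mem_coe, Finset.mem_filter, mem_trianglePoints ha hb] at *
        rw [mul_add, mul_add]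
        omega
      · rintro ⟨u, v⟩ hw
        simp only [Finset.mem_coe, Finset.mem_filter, mem_trianglePoints ha hb] at *
        obtain ⟨hw, h1, h2⟩ := hw
        obtain ⟨u, rfl⟩ := Nat.exists_eq_add_of_le' h1
        obtain ⟨v, rfl⟩ := Nat.exists_eq_add_of_le' h2
        rw [mul_add, mul_add] at hw
        simp only [Nat.add_sub_cancel]
        omega
      · rintro ⟨u, v⟩ -
        simp
      · rintro ⟨u, v⟩ hw
        simp only [Finset.mem_coe, Finset.mem_filter] at hw
        ext <;> simp <;> omega
  have haxes : ((trianglePoints a b n).filter fun w => ¬ (1 ≤ w.1 ∧ 1 ≤ w.2)) =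
      (Finset.range (n / a + 1)).image (fun u => (u, 0)) ∪
        (Finset.range (n / b)).image (fun v => (0, v + 1)) := by
    ext ⟨u, v⟩
    simp only [Finset.mem_filter, mem_trianglePoints ha hb, Finset.mem_union, Finset.mem_image,
      Finset.mem_range, Prod.mk.injEq, Nat.lt_succ_iff, Nat.lt_iff_add_one_le (n := n / b),
      Nat.le_div_iff_mul_le ha, Nat.le_div_iff_mul_le hb]
    constructor
    · rintro ⟨h, h'⟩
      rcases Nat.eq_zero_or_pos v with rfl | hv
      · exact Or.inl ⟨u, by rw [mul_comm]; omega, rfl, rfl⟩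
      · have hu : u = 0 := by omega
        subst hu
        refine Or.inr ⟨v - 1, ?_, rfl, by omega⟩
        rw [Nat.sub_add_cancel hv, mul_comm]
        omega
    · rintro (⟨u, h, rfl, rfl⟩ | ⟨v, h, rfl, rfl⟩)
      · exact ⟨by rw [mul_comm]; omega, by omega⟩
      · exact ⟨by rw [mul_comm b]; omega, by omega⟩
  have hcard := Finset.card_filter_add_card_filter_not (s := trianglePoints a b n)
    (fun w => 1 ≤ w.1 ∧ 1 ≤ w.2)
  rw [← hcard, hpos, haxes, Finset.card_union_of_disjoint, Finset.card_image_of_injective,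
    Finset.card_image_of_injective, Finset.card_range, Finset.card_range]
  · ring
  · intro v v' h
    simpa using h
  · intro u u' h
    simpa using h
  · rw [Finset.disjoint_left]
    simp only [Finset.mem_image]
    rintro _ ⟨u, -, rfl⟩ ⟨v, -, h⟩
    simp at h

lemma two_mul_card_trianglePoints {a b d : ℕ} (ha : 0 < a) (hlt : a < b) (hab : a + b = d)
    (hd : 9 * (a * b) + 1 = d * d) (J : ℕ) (hJ : J < d) :
    2 * (trianglePoints (3 * a) (3 * b) (J * d)).card =
      (J + 1) * (J + 2) + 2 * if 3 ∣ J then J / 3 / a else 0 := by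
  induction J using Nat.strong_induction_on with
  | _ J ih =>
    rw [card_trianglePoints (by omega) (by omega), div_add_div_add_one ha hlt hab hd hJ]
    have h3 : 3 * a + 3 * b = 3 * d := by omega
    rw [h3]
    rcases lt_or_ge J 3 with hJ3 | hJ3
    · rw [if_pos (by nlinarith)]
      interval_cases J
      · simp
      · simp
      · have h2 : ¬ 3 * a ∣ 2 := fun h => by
          have := Nat.le_of_dvd (by norm_num) h
          omega
        simp [h2]
    · obtain ⟨i, rfl⟩ := Nat.exists_eq_add_of_le' hJ3
      rw [if_neg (by nlinarith), show (i + 3) * d - 3 * d = i * d by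
        rw [add_mul]; omega, mul_add, ih i (by omega) (by omega)]
      by_cases h : 3 ∣ i
      · obtain ⟨l, rfl⟩ := h
        have e1 : (3 * l + 3) / 3 = l + 1 := by omega
        have e2 : 3 * l / 3 = l := by omega
        have e3 : 3 * a ∣ 3 * l + 3 ↔ a ∣ l + 1 := by
          rw [show 3 * l + 3 = 3 * (l + 1) by ring, Nat.mul_dvd_mul_iff_left (by norm_num)]
        rw [if_pos (show 3 ∣ 3 * l from ⟨l, rfl⟩), if_pos (show 3 ∣ 3 * l + 3 from ⟨l + 1, by ring⟩), e1, e2,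
          if_congr e3 rfl rfl, Nat.succ_div]
        ring
      · have h' : ¬ 3 ∣ i + 3 := by omega
        have h'' : ¬ 3 * a ∣ i + 3 := fun h => h' ((Dvd.intro _ rfl).trans h)
        rw [if_neg h, if_neg h', if_neg h'']
        ring

/-- A parametrization by lattice points: for values below `9 a b` this is a bijection onto the semigroup generated by `3 a`, `3 b` and `3 a b + 1`. -/
def latticeValue (a b : ℕ) (w : ℕ × ℕ) : ℕ :=
  3 * a * w.1 + 3 * b * w.2 + w.2 / a

lemma exists_of_mem_closure {g₀ g₁ g₂ x : ℕ}
    (hx : x ∈ AddSubmonoid.closure ({g₀, g₁, g₂} : Set ℕ)) :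
    ∃ u v c, x = g₀ * u + g₁ * v + g₂ * c := by
  induction hx using AddSubmonoid.closure_induction with
  | mem x hx =>
    rcases hx with rfl | rfl | rfl
    · exact ⟨1, 0, 0, by simp⟩
    · exact ⟨0, 1, 0, by simp⟩
    · exact ⟨0, 0, 1, by simp⟩
  | zero => exact ⟨0, 0, 0, by simp⟩
  | add x y _ _ hx hy =>
    obtain ⟨u, v, c, rfl⟩ := hx
    obtain ⟨u', v', c', rfl⟩ := hy
    exact ⟨u + u', v + v', c + c', by ring⟩

lemma exists_latticeValue_eq {a b x : ℕ} (ha : 0 < a)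
    (hx : x ∈ AddSubmonoid.closure ({3 * a, 3 * b, 3 * a * b + 1} : Set ℕ)) :
    ∃ w, latticeValue a b w = x := by
  obtain ⟨u, v, c, rfl⟩ := exists_of_mem_closure hx
  refine ⟨(u + b * (v / a), v % a + a * c), ?_⟩
  have h1 : (v % a + a * c) / a = c := by
    rw [Nat.add_mul_div_left _ _ ha, Nat.div_eq_of_lt (Nat.mod_lt _ ha), zero_add]
  rw [latticeValue, h1]
  have h2 := Nat.div_add_mod v a
  generalize v / a = q at *
  generalize v % a = r at *
  subst h2
  ring

lemma latticeValue_mem_closure (a b : ℕ) (w : ℕ × ℕ) :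
    latticeValue a b w ∈ AddSubmonoid.closure ({3 * a, 3 * b, 3 * a * b + 1} : Set ℕ) := by
  obtain ⟨u, v⟩ := w
  have h : latticeValue a b (u, v) =
      u • (3 * a) + (v % a) • (3 * b) + (v / a) • (3 * a * b + 1) := by
    simp only [latticeValue, smul_eq_mul]
    nth_rw 1 [← Nat.div_add_mod v a]
    ring
  rw [h]
  refine add_mem (add_mem ?_ ?_) ?_ <;>
    exact AddSubmonoid.nsmul_mem _ (AddSubmonoid.subset_closure (by simp)) _

lemma div_lt_three_of_latticeValue_lt {a b : ℕ} {w : ℕ × ℕ}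
    (h : 3 * a * w.1 + 3 * b * w.2 < 9 * (a * b)) : w.2 / a < 3 := by
  have : w.2 < 3 * a := by
    by_contra! hge
    have := Nat.mul_le_mul_left (3 * b) hge
    nlinarith
  exact Nat.div_lt_of_lt_mul (by rwa [mul_comm])

lemma latticeValue_injOn {a b : ℕ} (ha : 0 < a) (hc : Nat.Coprime a b) :
    Set.InjOn (latticeValue a b) {w | latticeValue a b w < 9 * (a * b)} := by
  rintro ⟨u, v⟩ hw ⟨u', v'⟩ hw' h
  simp only [Set.mem_ofPred_eq, latticeValue] at hw hw' h
  have hv := div_lt_three_of_latticeValue_lt (w := (u, v)) ((Nat.le_add_right _ _).trans_lt hw)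
  have hv' := div_lt_three_of_latticeValue_lt (w := (u', v')) ((Nat.le_add_right _ _).trans_lt hw')
  dsimp only at hv hv'
  simp only [mul_assoc] at h
  have hdiv : v / a = v' / a := by
    generalize v / a = q at *
    generalize v' / a = q' at *
    omega
  have hsum : a * u + b * v = a * u' + b * v' := by omega
  have hmod : b * v ≡ b * v' [MOD a] := by
    have := congrArg (· % a) hsum
    simpa [Nat.ModEq, Nat.mul_add_mod] using this
  have hmod' : v % a = v' % a := Nat.ModEq.cancel_left_of_coprime hc hmod
  have hvv : v = v' := by rw [← Nat.div_add_mod v a, ← Nat.div_add_mod v' a, hdiv, hmod']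
  subst hvv
  have : a * u = a * u' := by omega
  rw [Nat.eq_of_mul_eq_mul_left ha this]

lemma mul_add_mul_ne_mul {a b u v : ℕ} (ha : 0 < a) (hb : 0 < b)
    (hc : Nat.Coprime a b) (hu : 0 < u) (hv : 0 < v) :
    a * u + b * v ≠ a * b := by
  intro h
  have h1 : b ∣ a * u := (Nat.dvd_add_left (Dvd.intro _ rfl)).1 (h ▸ Dvd.intro_left _ rfl)
  have h2 : a ∣ b * v := (Nat.dvd_add_right (Dvd.intro _ rfl)).1 (h ▸ Dvd.intro _ rfl)
  have h3 := Nat.le_of_dvd hu (hc.symm.dvd_of_dvd_mul_left h1)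
  have h4 := Nat.le_of_dvd hv (hc.dvd_of_dvd_mul_left h2)
  have h5 := Nat.mul_le_mul_left a h3
  have h6 := Nat.mul_le_mul_left b h4
  have h7 : 0 < a * b := Nat.mul_pos ha hb
  linarith [mul_comm a b]

lemma three_dvd_of_dvd_mul {a b d J : ℕ} (hd : 9 * (a * b) + 1 = d * d) (h : 3 ∣ J * d) :
    3 ∣ J := by
  simpa using three_mul_dvd_of_dvd_mul (a := 1) (b := a * b) (by simpa using hd) h

lemma card_trianglePoints_filter_lt_latticeValue {a b d J : ℕ} (ha : 0 < a) (hlt : a < b)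
    (hab : a + b = d) (hd : 9 * (a * b) + 1 = d * d) (hJ : J < d) :
    ((trianglePoints (3 * a) (3 * b) (J * d)).filter
      fun w => ¬ latticeValue a b w ≤ J * d).card = if 3 ∣ J then J / 3 / a else 0 := by
  have hc := coprime_of_nine_mul_add_one hab hd
  have hb : 0 < b := ha.trans hlt
  have hbound : J * d + d ≤ 9 * (a * b) + 1 := by nlinarith
  have hchar : ∀ w ∈ (trianglePoints (3 * a) (3 * b) (J * d)).filter
      (fun w => ¬ latticeValue a b w ≤ J * d),
      3 * a * w.1 + 3 * b * w.2 = J * d ∧ a ≤ w.2 := by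
    rintro ⟨u, v⟩ hw
    rw [Finset.mem_filter, mem_trianglePoints (by omega) (by omega)] at hw
    obtain ⟨h1, h2⟩ := hw
    have hv := div_lt_three_of_latticeValue_lt (a := a) (b := b) (w := (u, v)) (by omega)
    simp only [latticeValue] at h1 h2 hv ⊢
    have hva : 1 ≤ v / a := by omega
    refine ⟨?_, by simpa using (Nat.le_div_iff_mul_le ha).1 hva⟩
    by_contra hne
    have hv2 : 2 ≤ v / a := by omega
    have heq : J * d = 3 * a * u + 3 * b * v + 1 := by omega
    obtain ⟨w, rfl⟩ := Nat.exists_eq_add_of_le ((Nat.le_div_iff_mul_le ha).1 hv2)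
    obtain ⟨e, he⟩ := Nat.exists_eq_add_of_lt hJ
    have hsum : 3 * (a * u + b * w) + (e + 1) * d = 3 * (a * b) := by
      have : d * d = J * d + (e + 1) * d := by
        rw [← add_mul, ← add_assoc, ← he]
      nlinarith
    obtain ⟨f, hf⟩ : 3 ∣ e + 1 :=
      three_dvd_of_dvd_mul hd ((Nat.dvd_add_right (Dvd.intro _ rfl)).1 (hsum ▸ Dvd.intro _ rfl))
    refine mul_add_mul_ne_mul (u := u + f) (v := w + f) ha hb hc (by omega) (by omega) ?_
    rw [hf, ← hab] at hsum
    linarith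
  split_ifs with h3
  · obtain ⟨i, rfl⟩ := h3
    rw [Nat.mul_div_cancel_left _ (by norm_num)]
    have himage : (trianglePoints (3 * a) (3 * b) (3 * i * d)).filter
        (fun w => ¬ latticeValue a b w ≤ 3 * i * d) =
        (Finset.range (i / a)).image fun s => (i + b * s, i - a * s) := by
      ext ⟨u, v⟩
      simp only [Finset.mem_image, Finset.mem_range, Prod.mk.injEq]
      constructor
      · intro hw
        obtain ⟨h1, h2⟩ := hchar _ hw
        dsimp only at h1 h2
        have h4 : a * u + b * v = a * i + b * i := by
          rw [← hab] at h1
          linarith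
        have hvi : v ≤ i := by
          by_contra! hvi
          obtain ⟨t, rfl⟩ := Nat.exists_eq_add_of_lt hvi
          have h5 : a * u + b * (t + 1) = a * i := by linarith
          have h6 : u < i := by
            by_contra! h6
            nlinarith
          obtain ⟨r, rfl⟩ := Nat.exists_eq_add_of_lt h6
          have h7 : a * (r + 1) = b * (t + 1) := by linarith
          have h8 := Nat.le_of_dvd (by omega)
            (hc.symm.dvd_of_dvd_mul_left (h7 ▸ Dvd.intro _ rfl : b ∣ a * (r + 1)))
          omega
        obtain ⟨t, rfl⟩ := Nat.exists_eq_add_of_le hvi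
        have h5 : a * u = a * (v + t) + b * t := by linarith
        obtain ⟨s, rfl⟩ : a ∣ t := hc.dvd_of_dvd_mul_left
          ((Nat.dvd_add_right (Dvd.intro _ rfl)).1 (h5 ▸ Dvd.intro _ rfl))
        refine ⟨s, ?_, ?_, by omega⟩
        · rw [Nat.lt_iff_add_one_le, Nat.le_div_iff_mul_le ha]
          linarith
        · exact Nat.eq_of_mul_eq_mul_left ha (by linarith)
      · rintro ⟨s, hs, rfl, rfl⟩
        rw [Nat.lt_iff_add_one_le, Nat.le_div_iff_mul_le ha] at hs
        obtain ⟨t, rfl⟩ : ∃ t, i = t + a * s := ⟨i - a * s, by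
          rw [Nat.sub_add_cancel]; linarith⟩
        rw [Nat.add_sub_cancel, Finset.mem_filter, mem_trianglePoints (by omega) (by omega)]
        have heq : 3 * a * (t + a * s + b * s) + 3 * b * t = 3 * (t + a * s) * d := by
          rw [← hab]; ring
        have hta : 1 ≤ t / a := (Nat.le_div_iff_mul_le ha).2 (by linarith)
        refine ⟨heq.le, ?_⟩
        simp only [latticeValue, heq]
        omega
    rw [himage, Finset.card_image_of_injective, Finset.card_range]
    intro s s' h
    simp only [Prod.mk.injEq] at h
    exact Nat.eq_of_mul_eq_mul_left hb (by omega)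
  · rw [Finset.card_eq_zero, Finset.eq_empty_iff_forall_notMem]
    intro w hw
    have h1 := (hchar w hw).1
    exact h3 (three_dvd_of_dvd_mul hd ⟨a * w.1 + b * w.2, by rw [← h1]; ring⟩)

theorem ncard_closure_le_mul {a b d J : ℕ} (ha : 0 < a) (hlt : a < b) (hab : a + b = d)
    (hd : 9 * (a * b) + 1 = d * d) (hJ : J < d) :
    {x : ℕ | x ∈ AddSubmonoid.closure ({3 * a, 3 * b, 3 * a * b + 1} : Set ℕ) ∧
      x ≤ J * d}.ncard = (J + 1) * (J + 2) / 2 := by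
  have hbound : J * d < 9 * (a * b) := by nlinarith
  set D := (trianglePoints (3 * a) (3 * b) (J * d)).filter fun w => latticeValue a b w ≤ J * d
    with hD
  have himage : {x : ℕ | x ∈ AddSubmonoid.closure ({3 * a, 3 * b, 3 * a * b + 1} : Set ℕ) ∧
      x ≤ J * d} = latticeValue a b '' (D : Set (ℕ × ℕ)) := by
    ext x
    simp only [hD, Set.mem_ofPred_eq, Set.mem_image, Finset.mem_coe, Finset.mem_filter]
    constructor
    · rintro ⟨hx, hle⟩
      obtain ⟨w, rfl⟩ := exists_latticeValue_eq ha hx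
      exact ⟨w, ⟨(mem_trianglePoints (by omega) (by omega)).2
        ((Nat.le_add_right _ _).trans hle), hle⟩, rfl⟩
    · rintro ⟨w, ⟨-, hw⟩, rfl⟩
      exact ⟨latticeValue_mem_closure a b w, hw⟩
  have hinj : Set.InjOn (latticeValue a b) (D : Set (ℕ × ℕ)) :=
    (latticeValue_injOn ha (coprime_of_nine_mul_add_one hab hd)).mono fun w hw =>
      (Finset.mem_filter.1 (Finset.mem_coe.1 hw)).2.trans_lt hbound
  rw [himage, hinj.ncard_image, Set.ncard_coe_finset]
  have h1 := two_mul_card_trianglePoints ha hlt hab hd J hJ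
  have h2 := card_trianglePoints_filter_lt_latticeValue ha hlt hab hd hJ
  have h3 := Finset.card_filter_add_card_filter_not (s := trianglePoints (3 * a) (3 * b) (J * d))
    (fun w => latticeValue a b w ≤ J * d)
  rw [← hD, h2] at h3
  symm
  apply Nat.div_eq_of_eq_mul_right two_pos
  linarith

/-- Family (vii): for `k ≥ 2` and `d = F(4k+2)`, the semigroup generated by
`F(4k)`, `F(4k+4)`, `3·(F(4k)/3)·(F(4k+4)/3) + 1` (singularity of type
`(F(4k)/3, F(4k+4)/3)(3,1)`) satisfies the Borodzik–Livingston counting condition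
`R(j·d) = (j+1)(j+2)/2` for `0 ≤ j ≤ d−3`. -/
theorem counting_condition_family_vii
    (k d : ℕ) (hk : 2 ≤ k) (hd : d = Nat.fib (4 * k + 2)) :
    ∀ j : ℕ, j ≤ d - 3 →
      {x : ℕ | x ∈ AddSubmonoid.closure
          ({Nat.fib (4 * k), Nat.fib (4 * k + 4),
            3 * (Nat.fib (4 * k) / 3) * (Nat.fib (4 * k + 4) / 3) + 1} : Set ℕ) ∧
        x ≤ j * d}.ncard = (j + 1) * (j + 2) / 2 := by
  intro j hj
  have h0 : 0 < Nat.fib (4 * k) := Nat.fib_pos.2 (by omega)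
  have h1 : 0 < Nat.fib (4 * k + 1) := Nat.fib_pos.2 (by omega)
  have hsq := fib_four_mul_add_one_sq k
  have h2 := Nat.fib_add_two (n := 4 * k)
  have h3 := Nat.fib_add_two (n := 4 * k + 1)
  have h4 := Nat.fib_add_two (n := 4 * k + 2)
  simp only [add_assoc, Nat.reduceAdd] at h2 h3 h4
  obtain ⟨a, ha⟩ : 3 ∣ Nat.fib (4 * k) := Nat.fib_dvd 4 (4 * k) ⟨k, rfl⟩
  obtain ⟨b, hb⟩ : 3 ∣ Nat.fib (4 * k + 4) := Nat.fib_dvd 4 (4 * k + 4) ⟨k + 1, by ring⟩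
  have hq : 9 * (a * b) + 1 = d * d := by
    have : Nat.fib (4 * k) * Nat.fib (4 * k + 4) + 1 = d * d := by
      rw [hd, h4, h3, h2]
      linarith
    rw [ha, hb] at this
    linarith
  rw [ha, hb, Nat.mul_div_cancel_left _ (by norm_num), Nat.mul_div_cancel_left _ (by norm_num)]
  exact ncard_closure_le_mul (by omega) (by omega) (by omega) hq (by omega)
end
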